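/- arXiv:2512.02428 — 2 statements merged into one kernel-verified Lean document; each statement's English description precedes it below -/
import Mathlib

section
/- For every positive integer q and every real x ≥ 1, | ∑_{n ≤ x, (n,q)=1} 1/n − (φ(q)/q)( log x + γ + ∑_{p | q} (log p)/(p − 1) ) | ≤ 2^{ν(q)}/x, where γ is Euler's constant and ν(q) is the number of distinct prime divisors of q. -/
theorem aux_base (x : ℝ) (hx : 0 < x) :
    |(∑ n ∈ Finset.Icc 1 ⌊x⌋₊, (1 : ℝ) / n) - (Real.log x + Real.eulerMascheroniConstant)| ≤ 1 / x := by
  have hH : (∑ n ∈ Finset.Icc 1 ⌊x⌋₊, (1 : ℝ) / n) = ((harmonic ⌊x⌋₊ : ℚ) : ℝ) := by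
    rw [harmonic_eq_sum_Icc]; push_cast; simp
  rw [hH]
  set n := ⌊x⌋₊ with hn
  have h1 : (n : ℝ) ≤ x := Nat.floor_le hx.le
  have h2 : x < n + 1 := Nat.lt_floor_add_one x
  have a := Real.eulerMascheroniSeq_lt_eulerMascheroniConstant n
  have b := Real.eulerMascheroniConstant_lt_eulerMascheroniSeq' (n + 1)
  rw [Real.eulerMascheroniSeq] at a
  rw [Real.eulerMascheroniSeq', if_neg (by omega), harmonic_succ] at b
  push_cast at b
  have hl : Real.log (n + 1) - Real.log x ≤ 1 / x := by
    rw [← Real.log_div (by positivity) hx.ne']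
    refine (Real.log_le_sub_one_of_pos (by positivity)).trans ?_
    rw [div_sub_one hx.ne']
    gcongr; linarith
  have hl2 : Real.log x ≤ Real.log (n + 1) := Real.log_le_log hx h2.le
  have h3 : ((n : ℝ) + 1)⁻¹ ≤ 1 / x := by
    rw [← one_div]; exact one_div_le_one_div_of_le hx h2.le
  rw [abs_le]
  constructor <;> linarith

theorem aux_split (S : Finset ℕ) (p : ℕ) (hp : p.Prime) (hS : ∀ r ∈ S, r.Prime) (hpS : p ∉ S) (x : ℝ) :
    (∑ n ∈ (Finset.Icc 1 ⌊x⌋₊).filter (fun n => ∀ r ∈ insert p S, ¬ r ∣ n), (1 : ℝ) / n) =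
    (∑ n ∈ (Finset.Icc 1 ⌊x⌋₊).filter (fun n => ∀ r ∈ S, ¬ r ∣ n), (1 : ℝ) / n) -
    1 / p * ∑ n ∈ (Finset.Icc 1 ⌊x / p⌋₊).filter (fun n => ∀ r ∈ S, ¬ r ∣ n), (1 : ℝ) / n := by
  rw [eq_sub_iff_add_eq, ← Finset.sum_filter_add_sum_filter_not
    ((Finset.Icc 1 ⌊x⌋₊).filter (fun n => ∀ r ∈ S, ¬ r ∣ n)) (fun n => ¬ p ∣ n)]
  congr 1
  · refine Finset.sum_congr ?_ fun _ _ => rfl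
    ext n
    simp only [Finset.mem_filter, Finset.forall_mem_insert]
    tauto
  · rw [Finset.mul_sum, Nat.floor_div_natCast]
    refine Finset.sum_bij (fun n _ => p * n) ?_ ?_ ?_ ?_
    · intro n hn
      simp only [Finset.mem_filter, Finset.mem_Icc] at hn ⊢
      obtain ⟨⟨h1, h2⟩, h3⟩ := hn
      refine ⟨⟨⟨Nat.mul_pos hp.pos h1, ?_⟩, ?_⟩, by simp⟩
      · rw [mul_comm]; exact (Nat.le_div_iff_mul_le hp.pos).1 h2
      · intro r hr hd
        rcases (hS r hr).dvd_mul.1 hd with h | h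
        · exact hpS (((Nat.prime_dvd_prime_iff_eq (hS r hr) hp).1 h) ▸ hr)
        · exact h3 r hr h
    · intro a _ b _ h
      exact Nat.eq_of_mul_eq_mul_left hp.pos h
    · intro n hn
      simp only [Finset.mem_filter, Finset.mem_Icc, not_not] at hn
      obtain ⟨⟨⟨h1, h2⟩, h3⟩, m, rfl⟩ := hn
      refine ⟨m, ?_, rfl⟩
      simp only [Finset.mem_filter, Finset.mem_Icc]
      refine ⟨⟨Nat.pos_of_mul_pos_left h1, ?_⟩, fun r hr hd => h3 r hr (hd.mul_left p)⟩
      rw [Nat.le_div_iff_mul_le hp.pos, mul_comm]; exact h2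
    · intro n _
      push_cast
      rw [one_div_mul_one_div]

theorem aux_main (S : Finset ℕ) (hS : ∀ r ∈ S, r.Prime) : ∀ x : ℝ, 0 < x →
    |(∑ n ∈ (Finset.Icc 1 ⌊x⌋₊).filter (fun n => ∀ r ∈ S, ¬ r ∣ n), (1 : ℝ) / n) -
      (∏ p ∈ S, (1 - (p : ℝ)⁻¹)) * (Real.log x + Real.eulerMascheroniConstant +
        ∑ p ∈ S, Real.log p / ((p : ℝ) - 1))| ≤ 2 ^ S.card / x := by
  induction S using Finset.induction_on with
  | empty => intro x hx; simpa using aux_base x hx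
  | insert p S hpS ih =>
    intro x hx
    have hp : p.Prime := hS p (by simp)
    have hS' : ∀ r ∈ S, r.Prime := fun r hr => hS r (by simp [hr])
    have hp1 : (1 : ℝ) < p := by exact_mod_cast hp.one_lt
    have hp0 : (0 : ℝ) < p := by linarith
    have hp2 : (p : ℝ) - 1 ≠ 0 := by linarith
    have e1 := ih hS' x hx
    have e2 := ih hS' (x / p) (by positivity)
    rw [aux_split S p hp hS' hpS, Finset.prod_insert hpS, Finset.sum_insert hpS,
      Finset.card_insert_of_notMem hpS]
    rw [Real.log_div hx.ne' hp0.ne'] at e2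
    generalize (∑ n ∈ (Finset.Icc 1 ⌊x⌋₊).filter (fun n => ∀ r ∈ S, ¬ r ∣ n), (1 : ℝ) / n) = A at *
    generalize (∑ n ∈ (Finset.Icc 1 ⌊x / p⌋₊).filter (fun n => ∀ r ∈ S, ¬ r ∣ n), (1 : ℝ) / n) = B at *
    generalize (∏ p ∈ S, (1 - (p : ℝ)⁻¹)) = P at *
    generalize (∑ p ∈ S, Real.log p / ((p : ℝ) - 1)) = L at *
    generalize Real.eulerMascheroniConstant = g at *
    generalize Real.log x = l at *
    generalize Real.log p = k at *
    have key : A - 1 / p * B - (1 - (p : ℝ)⁻¹) * P * (l + g + (k / (p - 1) + L)) =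
        (A - P * (l + g + L)) - 1 / p * (B - P * (l - k + g + L)) := by
      field_simp
      ring
    rw [key]
    refine (abs_sub _ _).trans ?_
    rw [abs_mul, abs_of_pos (by positivity : (0 : ℝ) < 1 / p)]
    have e3 := mul_le_mul_of_nonneg_left e2 (by positivity : (0 : ℝ) ≤ 1 / p)
    have e4 : (1 : ℝ) / p * (2 ^ S.card / (x / p)) = 2 ^ S.card / x := by field_simp
    have e5 : (2 : ℝ) ^ (S.card + 1) / x = 2 ^ S.card / x + 2 ^ S.card / x := by ring
    linarith

/-- Estimate for the sum of reciprocals of integers up to `x` coprime to `q`. -/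
theorem stmt_7 (q : ℕ) (hq : 0 < q) (x : ℝ) (hx : 1 ≤ x) :
    |(∑ n ∈ (Finset.Icc 1 ⌊x⌋₊).filter (fun n => n.Coprime q), (1 : ℝ) / n) -
      (q.totient : ℝ) / q * (Real.log x + Real.eulerMascheroniConstant +
        ∑ p ∈ q.primeFactors, Real.log p / ((p : ℝ) - 1))| ≤
      2 ^ q.primeFactors.card / x := by
  have h := aux_main q.primeFactors (fun r hr => Nat.prime_of_mem_primeFactors hr) x (by linarith)
  have h1 : (q.totient : ℝ) / q = ∏ p ∈ q.primeFactors, (1 - (p : ℝ)⁻¹) := by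
    have := congrArg (fun t : ℚ => (t : ℝ)) (Nat.totient_eq_mul_prod_factors q)
    push_cast at this
    rw [this]
    field_simp
  have h2 : (Finset.Icc 1 ⌊x⌋₊).filter (fun n => n.Coprime q) =
      (Finset.Icc 1 ⌊x⌋₊).filter (fun n => ∀ r ∈ q.primeFactors, ¬ r ∣ n) := by
    refine Finset.filter_congr fun n _ => ?_
    constructor
    · intro hc r hr hd
      exact Nat.not_coprime_of_dvd_of_dvd (Nat.prime_of_mem_primeFactors hr).one_lt hd
        (Nat.dvd_of_mem_primeFactors hr) hc
    · intro hr
      refine Nat.coprime_of_dvd fun k hk hkn hkq => ?_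
      exact hr k (Nat.mem_primeFactors.2 ⟨hk, hkq, hq.ne'⟩) hkn
  rw [h1, h2]
  exact h
end

section
/- Write ∑_{n ≤ x} τ(n) = x log x + (2γ − 1)x + Δ(x), where τ(n) is the number of divisors of n and γ is Euler's constant, and assume a bound |Δ(x)| ≤ C x^θ for all x ≥ 1, with constants C > 0 and θ > 1/4. Then for every positive integer q and every x ≥ 3, | ∑_{d | q} μ(d) ∑_{n ≤ x, (n,q)=1} { x/(d n) } − (φ(q)/q)² ( 1 − γ − ∑_{p | q} (log p)/(p−1) ) x | ≤ C σ♭_{−θ}(q)² x^θ + (φ(q)/q) 2^{ν(q)}, where σ♭_κ(q) := ∑_{d | q} μ(d)² d^κ, μ is the Möbius function, {y} denotes the fractional part of y, and ν(q) is the number of distinct prime divisors of q. -/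
namespace S8
open Finset

/-- `n` is coprime to all primes in `s`. -/
noncomputable def F (s : Finset ℕ) (n : ℕ) : ℝ := if ∀ p ∈ s, ¬ p ∣ n then 1 else 0

noncomputable def TT (s : Finset ℕ) (y : ℝ) : ℝ := ∑ n ∈ Icc 1 ⌊y⌋₊, F s n * (n.divisors.card : ℝ)
noncomputable def PP (s : Finset ℕ) : ℝ := ∏ p ∈ s, (1 - 1 / (p : ℝ))
noncomputable def LL (s : Finset ℕ) : ℝ := ∑ p ∈ s, Real.log p / ((p : ℝ) - 1)
noncomputable def mm (s : Finset ℕ) (y : ℝ) : ℝ :=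
  PP s ^ 2 * (y * (Real.log y + (2 * Real.eulerMascheroniConstant - 1) + 2 * LL s))
noncomputable def AA (s : Finset ℕ) (y : ℝ) : ℝ := TT s y - mm s y
noncomputable def EE (s : Finset ℕ) (y : ℝ) : ℝ :=
  y * (∑ n ∈ Icc 1 ⌊y⌋₊, F s n * (1 / (n : ℝ))) -
    PP s * (y * (Real.log y + Real.eulerMascheroniConstant + LL s))

lemma F_mul (s : Finset ℕ) (p : ℕ) (hp : p.Prime) (hs : ∀ r ∈ s, r.Prime) (hps : p ∉ s) (m : ℕ) :
    F s (p * m) = F s m := by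
  unfold F
  have : (∀ r ∈ s, ¬ r ∣ p * m) ↔ ∀ r ∈ s, ¬ r ∣ m := by
    refine forall₂_congr fun r hr => not_congr ?_
    constructor
    · intro h
      rcases (hs r hr).dvd_mul.1 h with h | h
      · exact absurd ((Nat.prime_dvd_prime_iff_eq (hs r hr) hp).1 h ▸ hr) hps
      · exact h
    · exact fun h => h.mul_left p
  simp only [this]

lemma F_insert (s : Finset ℕ) (p n : ℕ) :
    F (insert p s) n = if p ∣ n then 0 else F s n := by
  unfold F
  by_cases h : p ∣ n <;> simp [h]

lemma sum_dvd (p N : ℕ) (hp : 0 < p) (f : ℕ → ℝ) :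
    ∑ n ∈ Icc 1 N, (if p ∣ n then f (n / p) else 0) = ∑ m ∈ Icc 1 (N / p), f m := by
  rw [← sum_filter]
  symm
  apply sum_bij (fun m _ => p * m)
  · intro m hm
    simp only [mem_Icc, mem_filter] at hm ⊢
    refine ⟨⟨Nat.mul_pos hp hm.1, ?_⟩, dvd_mul_right _ _⟩
    calc p * m ≤ p * (N / p) := Nat.mul_le_mul_left _ hm.2
      _ ≤ N := Nat.mul_div_le _ _
  · intro a _ b _ h
    exact Nat.eq_of_mul_eq_mul_left hp h
  · intro n hn
    simp only [mem_Icc, mem_filter] at hn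
    obtain ⟨⟨h1, h2⟩, k, rfl⟩ := hn
    refine ⟨k, ?_, rfl⟩
    simp only [mem_Icc]
    refine ⟨Nat.pos_of_ne_zero (by rintro rfl; simp at h1), ?_⟩
    rw [Nat.le_div_iff_mul_le hp, mul_comm]; exact h2
  · intro m _
    rw [Nat.mul_div_cancel_left _ hp]

lemma tau_rec (p m : ℕ) (hp : p.Prime) (hm : 0 < m) :
    (((p * m).divisors.card : ℝ)) - 2 * (m.divisors.card : ℝ) +
      (if p ∣ m then ((m / p).divisors.card : ℝ) else 0) = 0 := by
  obtain ⟨k, r, hr, rfl⟩ := Nat.exists_eq_pow_mul_and_not_dvd hm.ne' p hp.ne_one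
  have key : ∀ j : ℕ, ((p ^ j * r).divisors.card : ℝ) = (j + 1) * (r.divisors.card : ℝ) := by
    intro j
    have hc : Nat.Coprime (p ^ j) r := Nat.Coprime.pow_left _ ((Nat.Prime.coprime_iff_not_dvd hp).2 hr)
    rw [hc.card_divisors_mul, Nat.divisors_prime_pow hp]
    simp
  have h1 : p * (p ^ k * r) = p ^ (k + 1) * r := by ring
  rw [h1, key, key]
  cases k with
  | zero => simp [hr]; ring
  | succ k =>
    have h2 : p ∣ p ^ (k + 1) * r := ⟨p ^ k * r, by ring⟩
    have h3 : p ^ (k + 1) * r / p = p ^ k * r := by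
      rw [pow_succ, show p ^ k * p * r = p * (p ^ k * r) by ring, Nat.mul_div_cancel_left _ hp.pos]
    rw [if_pos h2, h3, key]; push_cast; ring

lemma TT_insert (s : Finset ℕ) (p : ℕ) (hp : p.Prime) (hs : ∀ r ∈ s, r.Prime) (hps : p ∉ s)
    (y : ℝ) : TT (insert p s) y = TT s y - 2 * TT s (y / p) + TT s (y / p / p) := by
  unfold TT
  simp only [Nat.floor_div_natCast]
  set N := ⌊y⌋₊
  have e1 := sum_dvd p N hp.pos (fun m => F s m * (m.divisors.card : ℝ))
  have e2 := sum_dvd p (N / p) hp.pos (fun m => F s m * (m.divisors.card : ℝ))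
  have e3 := sum_dvd p N hp.pos (fun m => if p ∣ m then F s (m / p) * ((m / p).divisors.card : ℝ) else 0)
  rw [← e2, ← e1, ← e3, mul_sum, ← sum_sub_distrib, ← sum_add_distrib]
  refine sum_congr rfl fun n hn => ?_
  rw [F_insert]
  by_cases h : p ∣ n
  · simp only [h, if_true]
    obtain ⟨m, rfl⟩ := h
    have hm : 0 < m := Nat.pos_of_ne_zero (by rintro rfl; simp at hn)
    rw [Nat.mul_div_cancel_left _ hp.pos, F_mul s p hp hs hps]
    have hF : (if p ∣ m then F s (m / p) * ((m / p).divisors.card : ℝ) else 0)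
        = F s m * (if p ∣ m then ((m / p).divisors.card : ℝ) else 0) := by
      by_cases h2 : p ∣ m
      · obtain ⟨k, rfl⟩ := h2
        simp [Nat.mul_div_cancel_left _ hp.pos, F_mul s p hp hs hps]
      · simp [h2]
    rw [hF]
    have := tau_rec p m hp hm
    linear_combination (- F s m) * this
  · simp [h]

lemma PP_insert (s : Finset ℕ) (p : ℕ) (hps : p ∉ s) : PP (insert p s) = (1 - 1 / (p : ℝ)) * PP s := by
  unfold PP; rw [prod_insert hps]

lemma LL_insert (s : Finset ℕ) (p : ℕ) (hps : p ∉ s) :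
    LL (insert p s) = Real.log p / ((p : ℝ) - 1) + LL s := by
  unfold LL; rw [sum_insert hps]

lemma mm_insert (s : Finset ℕ) (p : ℕ) (hp : p.Prime) (hps : p ∉ s)
    (y : ℝ) (hy : 0 < y) : mm (insert p s) y = mm s y - 2 * mm s (y / p) + mm s (y / p / p) := by
  have h2 : (2 : ℝ) ≤ p := by exact_mod_cast hp.two_le
  have h0 : (p : ℝ) ≠ 0 := by positivity
  have h1 : (p : ℝ) - 1 ≠ 0 := by linarith
  unfold mm
  rw [PP_insert s p hps, LL_insert s p hps, Real.log_div (x := y / p) (by positivity) h0,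
    Real.log_div hy.ne' h0]
  field_simp
  ring

lemma AA_insert (s : Finset ℕ) (p : ℕ) (hp : p.Prime) (hs : ∀ r ∈ s, r.Prime) (hps : p ∉ s)
    (y : ℝ) (hy : 0 < y) : AA (insert p s) y = AA s y - 2 * AA s (y / p) + AA s (y / p / p) := by
  unfold AA
  rw [TT_insert s p hp hs hps, mm_insert s p hp hps y hy]; ring

lemma EE_insert (s : Finset ℕ) (p : ℕ) (hp : p.Prime) (hs : ∀ r ∈ s, r.Prime) (hps : p ∉ s)
    (y : ℝ) (hy : 0 < y) : EE (insert p s) y = EE s y - EE s (y / p) := by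
  have h2 : (2 : ℝ) ≤ p := by exact_mod_cast hp.two_le
  have h0 : (p : ℝ) ≠ 0 := by positivity
  have h1 : (p : ℝ) - 1 ≠ 0 := by linarith
  have hsum : ∑ n ∈ Icc 1 ⌊y⌋₊, F (insert p s) n * (1 / (n : ℝ)) =
      ∑ n ∈ Icc 1 ⌊y⌋₊, F s n * (1 / (n : ℝ)) -
        (1 / (p : ℝ)) * ∑ n ∈ Icc 1 ⌊y / p⌋₊, F s n * (1 / (n : ℝ)) := by
    simp only [Nat.floor_div_natCast]
    rw [mul_sum, ← sum_dvd p _ hp.pos (fun m => 1 / (p : ℝ) * (F s m * (1 / (m : ℝ)))), ← sum_sub_distrib]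
    refine sum_congr rfl fun n hn => ?_
    rw [F_insert]
    by_cases h : p ∣ n
    · obtain ⟨m, rfl⟩ := h
      simp only [dvd_mul_right, if_true]
      rw [Nat.mul_div_cancel_left _ hp.pos, F_mul s p hp hs hps]
      push_cast
      rw [one_div_mul_eq_div]
      field_simp
      ring
    · simp [h]
  unfold EE
  rw [hsum, PP_insert s p hps, LL_insert s p hps, Real.log_div hy.ne' h0]
  field_simp
  ring

/-- Induction bound for `EE`. -/
lemma EE_bound (K : ℝ) (h0 : ∀ y : ℝ, 0 < y → |EE ∅ y| ≤ K) (s : Finset ℕ) (hs : ∀ r ∈ s, r.Prime) :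
    ∀ y : ℝ, 0 < y → |EE s y| ≤ K * 2 ^ s.card := by
  induction s using Finset.induction_on with
  | empty => simpa using h0
  | insert p s hps ih =>
    intro y hy
    have hp := hs p (mem_insert_self _ _)
    have hs' : ∀ r ∈ s, r.Prime := fun r hr => hs r (mem_insert_of_mem hr)
    have hp0 : (0 : ℝ) < p := by exact_mod_cast hp.pos
    rw [EE_insert s p hp hs' hps y hy, card_insert_of_notMem hps]
    have a := ih hs' y hy
    have b := ih hs' (y / p) (by positivity)
    rw [abs_le] at *
    rw [pow_succ]
    constructor <;> linarith [a.1, a.2, b.1, b.2]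

/-- Induction bound for `AA`. -/
lemma AA_bound (s0 : Finset ℕ) (hs0 : ∀ r ∈ s0, r.Prime) (B M θ : ℝ)
    (h0 : ∀ y : ℝ, 0 < y → |AA s0 y| ≤ B * y ^ θ + M * y ^ (1 / 2 : ℝ))
    (s : Finset ℕ) (hs : ∀ r ∈ s, r.Prime) (hd : Disjoint s s0) :
    ∀ y : ℝ, 0 < y → |AA (s ∪ s0) y| ≤ B * (∏ p ∈ s, (1 + (p : ℝ) ^ (-θ)) ^ 2) * y ^ θ +
      M * (∏ p ∈ s, (1 + (p : ℝ) ^ (-(1 / 2) : ℝ)) ^ 2) * y ^ (1 / 2 : ℝ) := by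
  induction s using Finset.induction_on with
  | empty => simpa using h0
  | insert p s hps ih =>
    intro y hy
    have hp := hs p (mem_insert_self _ _)
    have hs' : ∀ r ∈ s, r.Prime := fun r hr => hs r (mem_insert_of_mem hr)
    rw [disjoint_insert_left] at hd
    have hp0 : (0 : ℝ) < p := by exact_mod_cast hp.pos
    have hpu : p ∉ s ∪ s0 := by simp [hps, hd.1]
    have hsu : ∀ r ∈ s ∪ s0, r.Prime := by
      intro r hr; rcases mem_union.1 hr with h | h
      · exact hs' r h
      · exact hs0 r h
    rw [insert_union, AA_insert _ p hp hsu hpu y hy, prod_insert hps, prod_insert hps]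
    have a := ih hs' hd.2 y hy
    have b := ih hs' hd.2 (y / p) (by positivity)
    have c := ih hs' hd.2 (y / p / p) (by positivity)
    have e : ∀ z t : ℝ, 0 < z → (z / p) ^ t = z ^ t * (p : ℝ) ^ (-t) := by
      intro z t hz
      rw [Real.div_rpow hz.le hp0.le, Real.rpow_neg hp0.le]; rfl
    have hyp : 0 < y / p := by positivity
    rw [e _ _ hyp, e _ _ hyp] at c
    rw [e _ _ hy, e _ _ hy] at b c
    set X := B * ∏ p ∈ s, (1 + (p : ℝ) ^ (-θ)) ^ 2
    set Y := M * ∏ p ∈ s, (1 + (p : ℝ) ^ (-(1 / 2) : ℝ)) ^ 2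
    set u := (p : ℝ) ^ (-θ)
    set v := (p : ℝ) ^ (-(1 / 2) : ℝ)
    have : B * ((1 + u) ^ 2 * ∏ p ∈ s, (1 + (p : ℝ) ^ (-θ)) ^ 2) * y ^ θ +
        M * ((1 + v) ^ 2 * ∏ p ∈ s, (1 + (p : ℝ) ^ (-(1 / 2) : ℝ)) ^ 2) * y ^ (1 / 2 : ℝ) =
        (X * y ^ θ + Y * y ^ (1 / 2 : ℝ)) + 2 * (X * (y ^ θ * u) + Y * (y ^ (1 / 2 : ℝ) * v)) +
        (X * (y ^ θ * u * u) + Y * (y ^ (1 / 2 : ℝ) * v * v)) := by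
      simp only [X, Y]; ring
    rw [this]
    rw [abs_le] at *
    constructor <;> linarith [a.1, a.2, b.1, b.2, c.1, c.2]
end S8

namespace S8
open Finset

lemma sum_sqfree (q : ℕ) (hq : 0 < q) (G : ℕ → ℝ) (g : ℕ → ℝ)
    (h0 : ∀ d, ¬ Squarefree d → G d = 0)
    (h1 : ∀ t : Finset ℕ, (∀ p ∈ t, p.Prime) → G (∏ p ∈ t, p) = ∏ p ∈ t, g p) :
    ∑ d ∈ q.divisors, G d = ∏ p ∈ q.primeFactors, (1 + g p) := by
  have e1 : ∑ d ∈ q.divisors, G d = ∑ d ∈ q.divisors with Squarefree d, G d := by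
    rw [sum_filter]
    refine sum_congr rfl fun d _ => ?_
    by_cases h : Squarefree d
    · simp [h]
    · simp [h, h0 d h]
  have e2 : (UniqueFactorizationMonoid.normalizedFactors q).toFinset = q.primeFactors := by
    rw [Nat.factors_eq]; rfl
  rw [e1, Nat.sum_divisors_filter_squarefree hq.ne', e2, prod_one_add]
  refine sum_congr rfl fun t ht => ?_
  rw [← h1 t]
  · congr 1
    exact Finset.prod_val t
  · intro p hp
    exact Nat.prime_of_mem_primeFactors (mem_powerset.1 ht hp)

lemma moebius_prod (t : Finset ℕ) (ht : ∀ p ∈ t, p.Prime) :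
    (ArithmeticFunction.moebius (∏ p ∈ t, p) : ℝ) = ∏ p ∈ t, (-1 : ℝ) := by
  induction t using Finset.induction_on with
  | empty => simp
  | insert p s hps ih =>
    have hp := ht p (mem_insert_self _ _)
    have hs' : ∀ r ∈ s, r.Prime := fun r hr => ht r (mem_insert_of_mem hr)
    have hc : Nat.Coprime p (∏ r ∈ s, r) := by
      apply Nat.Coprime.prod_right
      intro r hr
      exact (Nat.coprime_primes hp (hs' r hr)).2 (by rintro rfl; exact hps hr)
    rw [prod_insert hps, prod_insert hps,
      ArithmeticFunction.isMultiplicative_moebius.map_mul_of_coprime hc,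
      ArithmeticFunction.moebius_apply_prime hp]
    push_cast
    rw [ih hs']

lemma sum_sigma (q : ℕ) (hq : 0 < q) (θ : ℝ) :
    ∑ d ∈ q.divisors, (ArithmeticFunction.moebius d : ℝ) ^ 2 * (d : ℝ) ^ (-θ) =
      ∏ p ∈ q.primeFactors, (1 + (p : ℝ) ^ (-θ)) := by
  apply sum_sqfree q hq
  · intro d hd
    rw [ArithmeticFunction.moebius_eq_zero_of_not_squarefree hd]; simp
  · intro t ht
    rw [moebius_prod t ht]
    push_cast
    rw [← Real.finsetProd_rpow _ _ (fun i _ => by positivity)]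
    simp only [prod_const]
    rw [← pow_mul, mul_comm _ 2, pow_mul]
    simp

lemma sum_mu_div (q : ℕ) (hq : 0 < q) :
    ∑ d ∈ q.divisors, (ArithmeticFunction.moebius d : ℝ) * (1 / (d : ℝ)) =
      PP q.primeFactors := by
  unfold PP
  simp only [sub_eq_add_neg]
  apply sum_sqfree q hq
  · intro d hd
    rw [ArithmeticFunction.moebius_eq_zero_of_not_squarefree hd]; simp
  · intro t ht
    rw [moebius_prod t ht, ]
    push_cast
    rw [one_div, ← prod_inv_distrib, ← prod_mul_distrib]
    refine prod_congr rfl fun p _ => by simp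

lemma totient_PP (q : ℕ) (hq : 0 < q) : (q.totient : ℝ) / q = PP q.primeFactors := by
  have := Nat.totient_eq_mul_prod_factors q
  have h2 : (q.totient : ℝ) = q * ∏ p ∈ q.primeFactors, (1 - (p : ℝ)⁻¹) := by
    have := congrArg (fun z : ℚ => (z : ℝ)) this
    push_cast at this
    exact this
  rw [h2, PP]
  have : (q : ℝ) ≠ 0 := by positivity
  rw [mul_div_cancel_left₀ _ this]
  simp

lemma F_eq (q : ℕ) (hq : 0 < q) (n : ℕ) :
    F q.primeFactors n = if n.Coprime q then 1 else 0 := by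
  unfold F
  have : (∀ p ∈ q.primeFactors, ¬ p ∣ n) ↔ n.Coprime q := by
    constructor
    · intro h
      apply Nat.Coprime.symm
      apply Nat.coprime_of_dvd
      intro k hk h1 h2
      exact h k (Nat.mem_primeFactors.2 ⟨hk, h1, hq.ne'⟩) h2
    · intro h p hp hpn
      have := Nat.mem_primeFactors.1 hp
      exact this.1.one_lt.ne' (Nat.dvd_one.1 (h ▸ Nat.dvd_gcd hpn this.2.1))
  simp only [this]

lemma sum_mu_ind (q : ℕ) (hq : 0 < q) (m : ℕ) :
    ∑ d ∈ q.divisors, (ArithmeticFunction.moebius d : ℝ) * (if d ∣ m then 1 else 0) =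
      F q.primeFactors m := by
  rw [F_eq q hq]
  have e : ∑ d ∈ q.divisors, (ArithmeticFunction.moebius d : ℝ) * (if d ∣ m then 1 else 0) =
      ∑ d ∈ (m.gcd q).divisors, (ArithmeticFunction.moebius d : ℝ) := by
    simp only [mul_ite, mul_one, mul_zero]
    rw [← sum_filter]
    refine sum_congr ?_ fun _ _ => rfl
    ext d
    simp only [mem_filter, Nat.mem_divisors, Nat.dvd_gcd_iff]
    have h1 : m.gcd q ≠ 0 := (Nat.gcd_pos_of_pos_right _ hq).ne'
    have h2 : q ≠ 0 := hq.ne'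
    constructor
    · rintro ⟨⟨a, _⟩, b⟩
      exact ⟨⟨b, a⟩, h1⟩
    · rintro ⟨⟨a, b⟩, _⟩
      exact ⟨⟨b, h2⟩, a⟩
  rw [e]
  have h := ArithmeticFunction.coe_mul_zeta_apply (R := ℤ) (f := ArithmeticFunction.moebius) (x := m.gcd q)
  rw [ArithmeticFunction.moebius_mul_coe_zeta, ArithmeticFunction.one_apply] at h
  have h' := congrArg (fun z : ℤ => (z : ℝ)) h
  push_cast at h'
  rw [← h']

lemma sum_mu_floor (q : ℕ) (hq : 0 < q) (z : ℝ) (hz : 0 ≤ z) :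
    ∑ d ∈ q.divisors, (ArithmeticFunction.moebius d : ℝ) * (⌊z / d⌋ : ℝ) =
      ∑ m ∈ Icc 1 ⌊z⌋₊, F q.primeFactors m := by
  have : ∀ d ∈ q.divisors, (⌊z / d⌋ : ℝ) = ∑ m ∈ Icc 1 ⌊z⌋₊, (if d ∣ m then 1 else 0) := by
    intro d hd
    have hd0 := Nat.pos_of_mem_divisors hd
    rw [sum_dvd d ⌊z⌋₊ hd0 (fun _ => 1), ← Nat.floor_div_natCast]
    simp only [sum_const, Nat.card_Icc, nsmul_eq_mul, mul_one, Nat.add_sub_cancel]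
    rw [natCast_floor_eq_intCast_floor (by positivity)]
  rw [sum_congr rfl fun d hd => by rw [this d hd, mul_sum], sum_comm]
  exact sum_congr rfl fun m _ => sum_mu_ind q hq m

lemma TT_eq (q : ℕ) (hq : 0 < q) (x : ℝ) (hx : 0 ≤ x) :
    ∑ n ∈ Icc 1 ⌊x⌋₊, F q.primeFactors n * ∑ m ∈ Icc 1 ⌊x / n⌋₊, F q.primeFactors m =
      TT q.primeFactors x := by
  unfold TT
  simp only [Nat.floor_div_natCast]
  set N := ⌊x⌋₊
  have e : ∀ n ∈ Icc 1 N, F q.primeFactors n * ∑ m ∈ Icc 1 (N / n), F q.primeFactors m =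
      ∑ k ∈ Icc 1 N, (if n ∣ k then F q.primeFactors k else 0) := by
    intro n hn
    have hn0 : 0 < n := (mem_Icc.1 hn).1
    rw [← sum_dvd n N hn0, mul_sum]
    refine sum_congr rfl fun k _ => ?_
    by_cases h : n ∣ k
    · obtain ⟨m, rfl⟩ := h
      simp only [dvd_mul_right, if_true]
      rw [Nat.mul_div_cancel_left _ hn0]
      simp only [F_eq q hq, Nat.coprime_mul_iff_left]
      split_ifs <;> simp_all
    · simp [h]
  rw [sum_congr rfl e, sum_comm]
  refine sum_congr rfl fun k hk => ?_
  rw [← sum_filter, sum_const, nsmul_eq_mul, mul_comm]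
  congr 3
  ext d
  simp only [mem_filter, mem_Icc, Nat.mem_divisors] at hk ⊢
  constructor
  · rintro ⟨_, h⟩; exact ⟨h, by omega⟩
  · rintro ⟨h, _⟩
    exact ⟨⟨Nat.pos_of_dvd_of_pos h hk.1, (Nat.le_of_dvd hk.1 h).trans hk.2⟩, h⟩

lemma main_id (q : ℕ) (hq : 0 < q) (x : ℝ) (hx : 0 < x) :
    (∑ d ∈ q.divisors, (ArithmeticFunction.moebius d : ℝ) *
        ∑ n ∈ (Finset.Icc 1 ⌊x⌋₊).filter (fun n => n.Coprime q), Int.fract (x / (d * n))) -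
      ((q.totient : ℝ) / q) ^ 2 * (1 - Real.eulerMascheroniConstant -
        ∑ p ∈ q.primeFactors, Real.log p / ((p : ℝ) - 1)) * x =
    PP q.primeFactors * EE q.primeFactors x - AA q.primeFactors x := by
  have e1 : (∑ d ∈ q.divisors, (ArithmeticFunction.moebius d : ℝ) *
        ∑ n ∈ (Finset.Icc 1 ⌊x⌋₊).filter (fun n => n.Coprime q), Int.fract (x / (d * n))) =
      ∑ n ∈ Icc 1 ⌊x⌋₊, F q.primeFactors n * ((x / n) * PP q.primeFactors -
        ∑ m ∈ Icc 1 ⌊x / n⌋₊, F q.primeFactors m) := by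
    simp only [mul_sum]
    rw [sum_comm, sum_filter]
    refine sum_congr rfl fun n hn => ?_
    rw [F_eq q hq]
    split_ifs with h
    · rw [one_mul, ← sum_mu_floor q hq (x / n) (by positivity), ← sum_mu_div q hq, mul_sum,
        ← sum_sub_distrib]
      refine sum_congr rfl fun d _ => ?_
      have : x / (d * n) = x / n / d := by rw [div_div, mul_comm (d : ℝ)]
      rw [this, Int.fract]; ring
    · simp
  rw [e1]
  simp only [mul_sub, sum_sub_distrib]
  rw [TT_eq q hq x hx.le, totient_PP q hq, AA, EE, mm]
  have : ∑ n ∈ Icc 1 ⌊x⌋₊, F q.primeFactors n * (x / n * PP q.primeFactors) =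
      PP q.primeFactors * (x * ∑ n ∈ Icc 1 ⌊x⌋₊, F q.primeFactors n * (1 / (n : ℝ))) := by
    rw [mul_sum, mul_sum]
    refine sum_congr rfl fun n _ => by ring
  rw [this, ← LL]
  ring

/-- Reduction of the theorem. -/
lemma reduction (C θ : ℝ) (q : ℕ) (hq : 0 < q) (x : ℝ) (hx : 3 ≤ x)
    (hE : |EE q.primeFactors x| ≤ Real.eulerMascheroniConstant * 2 ^ q.primeFactors.card)
    (hA : |AA q.primeFactors x| ≤ C * (∏ p ∈ q.primeFactors, (1 + (p : ℝ) ^ (-θ)) ^ 2) * x ^ θ +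
      (1 - Real.eulerMascheroniConstant) * ∏ p ∈ q.primeFactors, (2 - 2 / (p : ℝ))) :
    |(∑ d ∈ q.divisors, (ArithmeticFunction.moebius d : ℝ) *
        ∑ n ∈ (Finset.Icc 1 ⌊x⌋₊).filter (fun n => n.Coprime q), Int.fract (x / (d * n))) -
      ((q.totient : ℝ) / q) ^ 2 * (1 - Real.eulerMascheroniConstant -
        ∑ p ∈ q.primeFactors, Real.log p / ((p : ℝ) - 1)) * x| ≤
      C * (∑ d ∈ q.divisors, (ArithmeticFunction.moebius d : ℝ) ^ 2 * (d : ℝ) ^ (-θ)) ^ 2 * x ^ θ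
        + (q.totient : ℝ) / q * 2 ^ q.primeFactors.card := by
  rw [main_id q hq x (by linarith), sum_sigma q hq, totient_PP q hq, ← prod_pow]
  have hP : ∏ p ∈ q.primeFactors, (2 - 2 / (p : ℝ)) = PP q.primeFactors * 2 ^ q.primeFactors.card := by
    rw [PP, ← prod_const, ← prod_mul_distrib]
    exact prod_congr rfl fun p _ => by ring
  rw [hP] at hA
  have hP0 : 0 ≤ PP q.primeFactors := by
    rw [← totient_PP q hq]; positivity
  have h3 := mul_le_mul_of_nonneg_left hE hP0
  calc _ ≤ |PP q.primeFactors * EE q.primeFactors x| + |AA q.primeFactors x| := abs_sub _ _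
    _ ≤ _ := by rw [abs_mul, abs_of_nonneg hP0]; linarith
end S8

namespace S8
open Finset


/-! Divisor sum -/
noncomputable def DD (n : ℕ) : ℝ := ∑ m ∈ Icc 1 n, (m.divisors.card : ℝ)

lemma TT_empty (y : ℝ) : TT ∅ y = DD ⌊y⌋₊ := by
  simp [TT, DD, F]

lemma tau_split (m : ℕ) (hm : 0 < m) (K : ℕ) (hK : m < (K + 1) ^ 2) :
    (m.divisors.card : ℤ) = ∑ a ∈ Icc 1 K, (if a * a ≤ m then (if a * a < m then (if a ∣ m then 2 else 0) else 1) else 0) := by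
  classical
  have h1 : m.divisors.card = (m.divisors.filter (fun d => d * d < m)).card +
      (m.divisors.filter (fun d => d * d = m)).card + (m.divisors.filter (fun d => m < d * d)).card := by
    rw [← card_union_of_disjoint, ← card_union_of_disjoint]
    · congr 1; ext d
      simp only [mem_union, mem_filter]
      have := lt_trichotomy (d * d) m
      tauto
    · rw [disjoint_left]; intro d; simp only [mem_union, mem_filter]; omega
    · rw [disjoint_left]; intro d; simp only [mem_filter]; omega
  have h2 : (m.divisors.filter (fun d => m < d * d)).card = (m.divisors.filter (fun d => d * d < m)).card := by
    refine card_nbij' (fun d => m / d) (fun d => m / d) ?_ ?_ ?_ ?_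
    · intro d hd
      simp only [coe_filter, Set.mem_ofPred_eq, Nat.mem_divisors] at hd ⊢
      obtain ⟨⟨⟨e, rfl⟩, h0⟩, h⟩ := hd
      have hd0 : 0 < d := Nat.pos_of_mul_pos_right hm |> fun _ => by by_contra hh; simp at hh; subst hh; simp at hm
      rw [Nat.mul_div_cancel_left _ hd0]
      refine ⟨⟨dvd_mul_left _ _, h0⟩, ?_⟩
      have he : e < d := by nlinarith
      have he0 : 0 < e := by by_contra hh; simp at hh; subst hh; simp at hm
      nlinarith
    · intro d hd
      simp only [coe_filter, Set.mem_ofPred_eq, Nat.mem_divisors] at hd ⊢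
      obtain ⟨⟨⟨e, rfl⟩, h0⟩, h⟩ := hd
      have hd0 : 0 < d := by by_contra hh; simp at hh; subst hh; simp at hm
      rw [Nat.mul_div_cancel_left _ hd0]
      refine ⟨⟨dvd_mul_left _ _, h0⟩, ?_⟩
      have he : d < e := by nlinarith
      nlinarith
    · intro d hd
      simp only [coe_filter, Set.mem_ofPred_eq, Nat.mem_divisors] at hd ⊢
      exact Nat.div_div_self hd.1.1 hd.1.2
    · intro d hd
      simp only [coe_filter, Set.mem_ofPred_eq, Nat.mem_divisors] at hd ⊢
      exact Nat.div_div_self hd.1.1 hd.1.2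
  have h3 : (m.divisors.filter (fun d => d * d < m)) = (Icc 1 K).filter (fun d => d * d < m ∧ d ∣ m) := by
    ext d
    simp only [mem_filter, Nat.mem_divisors, mem_Icc]
    constructor
    · rintro ⟨⟨a, _⟩, b⟩
      refine ⟨⟨Nat.pos_of_dvd_of_pos a hm, ?_⟩, b, a⟩
      by_contra hh
      have : K + 1 ≤ d := by omega
      nlinarith
    · rintro ⟨_, b, a⟩
      exact ⟨⟨a, hm.ne'⟩, b⟩
  have h4 : (m.divisors.filter (fun d => d * d = m)) = (Icc 1 K).filter (fun d => d * d = m) := by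
    ext d
    simp only [mem_filter, Nat.mem_divisors, mem_Icc]
    constructor
    · rintro ⟨⟨a, _⟩, b⟩
      refine ⟨⟨Nat.pos_of_dvd_of_pos a hm, ?_⟩, b⟩
      by_contra hh
      have : K + 1 ≤ d := by omega
      nlinarith
    · rintro ⟨_, b⟩
      exact ⟨⟨⟨d, b.symm⟩, hm.ne'⟩, b⟩
  rw [h1, h2, h3, h4]
  push_cast
  rw [card_filter, card_filter]
  push_cast
  rw [← sum_add_distrib, ← sum_add_distrib]
  refine sum_congr rfl fun a _ => ?_
  by_cases c1 : a * a < m <;> by_cases c2 : a * a = m <;> by_cases c3 : a ∣ m <;> simp_all <;> omega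

lemma DD_hyp (K : ℕ) (n : ℕ) (hn : n < (K + 1) ^ 2) :
    DD n = ((∑ a ∈ Icc 1 K, (if a * a ≤ n then 2 * ((n / a : ℕ) : ℤ) + 1 - 2 * a else 0) : ℤ) : ℝ) := by
  induction n with
  | zero =>
    simp only [DD]
    have : ∀ a ∈ Icc 1 K, (if a * a ≤ 0 then 2 * ((0 / a : ℕ) : ℤ) + 1 - 2 * a else 0) = 0 := by
      intro a ha
      have := (mem_Icc.1 ha).1
      rw [if_neg]; nlinarith
    rw [sum_congr rfl this]; simp
  | succ n ih =>
    have e : DD (n + 1) = DD n + ((n + 1).divisors.card : ℝ) := by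
      unfold DD
      rw [Finset.sum_Icc_succ_top (by omega)]
    rw [e, ih (by omega)]
    have h := tau_split (n + 1) (by omega) K hn
    have h' : (((n + 1).divisors.card : ℤ) : ℝ) = _ := congrArg (fun z : ℤ => (z : ℝ)) h
    rw [Int.cast_natCast] at h'
    rw [h', ← Int.cast_add, ← sum_add_distrib]
    congr 1
    refine sum_congr rfl fun a ha => ?_
    have ha0 := (mem_Icc.1 ha).1
    rw [Nat.succ_div]
    by_cases c1 : a * a ≤ n
    · have : a * a ≤ n + 1 := by omega
      have : a * a < n + 1 := by omega
      simp only [*, if_true]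
      split_ifs <;> push_cast <;> ring
    · by_cases c2 : a * a = n + 1
      · have h5 : ¬ (a * a < n + 1) := by omega
        have h6 : a ∣ n + 1 := ⟨a, c2.symm⟩
        have h7 : a * a ≤ n + 1 := by omega
        have h8 : n / a + 1 = a := by
          have := Nat.succ_div_of_dvd h6
          rw [← this, ← c2, Nat.mul_div_cancel_left _ ha0]
        simp only [c1, h5, h6, h7, if_true, if_false]
        push_cast
        have : ((n / a : ℕ) : ℤ) + 1 = a := by exact_mod_cast h8
        push_cast at this
        linarith
      · have h5 : ¬ (a * a ≤ n + 1) := by omega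
        simp [c1, h5]

/-! Harmonic numbers -/
noncomputable def rr (n : ℕ) : ℝ := Real.log n + Real.eulerMascheroniConstant + 1 / (2 * n) - (harmonic n : ℝ)

lemma log_le_half (z : ℝ) (hz : 1 ≤ z) : Real.log z ≤ (z - 1 / z) / 2 := by
  have h := Real.self_le_sinh_iff.2 (Real.log_nonneg hz)
  rwa [Real.sinh_log (by linarith), ← one_div] at h

lemma le_log_frac (z : ℝ) (hz : 1 ≤ z) : 2 * (z - 1) / (z + 1) ≤ Real.log z := by
  have h := Real.sum_range_le_log_div (x := (z - 1) / (z + 1)) (by apply div_nonneg <;> linarith)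
    (by rw [div_lt_one] <;> linarith) 1
  have e : (1 + (z - 1) / (z + 1)) / (1 - (z - 1) / (z + 1)) = z := by
    have : z + 1 ≠ 0 := by linarith
    have h2 : 1 - (z - 1) / (z + 1) = 2 / (z + 1) := by field_simp; ring
    rw [h2]; field_simp; ring
  rw [e] at h
  simp at h
  have : 2 * (z - 1) / (z + 1) = 2 * ((z - 1) / (z + 1)) := by ring
  linarith

lemma rr_step (n : ℕ) (hn : 1 ≤ n) : rr (n + 1) ≤ rr n ∧
    rr n - 1 / (8 * (n : ℝ) ^ 2) ≤ rr (n + 1) - 1 / (8 * ((n + 1 : ℕ) : ℝ) ^ 2) := by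
  have hn' : (1 : ℝ) ≤ n := by exact_mod_cast hn
  have hz : (1 : ℝ) ≤ (n + 1) / n := by rw [le_div_iff₀] <;> linarith
  have h1 := log_le_half _ hz
  have h2 := le_log_frac _ hz
  rw [Real.log_div (by positivity) (by positivity)] at h1 h2
  have e : rr n - rr (n + 1) = (1 / (n : ℝ) + 1 / (n + 1)) / 2 - (Real.log (n + 1) - Real.log n) := by
    unfold rr
    rw [harmonic_succ]
    push_cast
    field_simp
    ring
  have e1 : (((n : ℝ) + 1) / n - 1 / ((n + 1) / n)) / 2 = (1 / (n : ℝ) + 1 / (n + 1)) / 2 := by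
    field_simp; ring
  have e2 : 2 * (((n : ℝ) + 1) / n - 1) / ((n + 1) / n + 1) = 2 / (2 * n + 1) := by
    field_simp; ring
  rw [e1] at h1
  rw [e2] at h2
  constructor
  · linarith
  · have : (1 / (n : ℝ) + 1 / (n + 1)) / 2 - 2 / (2 * n + 1) ≤ 1 / (8 * (n : ℝ) ^ 2) - 1 / (8 * ((n + 1 : ℕ) : ℝ) ^ 2) := by
      push_cast
      rw [← sub_nonneg]
      have : 1 / (8 * (n : ℝ) ^ 2) - 1 / (8 * ((n + 1) : ℝ) ^ 2) - ((1 / (n : ℝ) + 1 / (n + 1)) / 2 - 2 / (2 * n + 1))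
        = 1 / (8 * n ^ 2 * (n + 1) ^ 2 * (2 * n + 1)) := by
        field_simp; ring
      rw [this]; positivity
    linarith

lemma rr_tendsto : Filter.Tendsto rr Filter.atTop (nhds 0) := by
  have h1 := Real.tendsto_harmonic_sub_log
  have h2 : Filter.Tendsto (fun n : ℕ => 1 / (2 * (n : ℝ))) Filter.atTop (nhds 0) := by
    have := (tendsto_const_nhds (x := (1 / 2 : ℝ))).div_atTop (tendsto_natCast_atTop_atTop (R := ℝ))
    refine this.congr fun n => by rw [div_div]
  have := ((tendsto_const_nhds (x := Real.eulerMascheroniConstant)).sub h1).add h2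
  simp only [sub_self, zero_add] at this
  refine this.congr fun n => by unfold rr; ring

lemma rr_bounds (n : ℕ) (hn : 1 ≤ n) : 0 ≤ rr n ∧ rr n ≤ 1 / (8 * (n : ℝ) ^ 2) := by
  have hl := rr_tendsto
  have hl2 : Filter.Tendsto (fun n : ℕ => rr n - 1 / (8 * (n : ℝ) ^ 2)) Filter.atTop (nhds 0) := by
    have h3 : Filter.Tendsto (fun n : ℕ => 8 * (n : ℝ) ^ 2) Filter.atTop Filter.atTop := by
      apply Filter.Tendsto.const_mul_atTop (by norm_num)
      exact (Filter.tendsto_pow_atTop (by norm_num)).comp tendsto_natCast_atTop_atTop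
    have := hl.sub ((tendsto_const_nhds (x := (1 : ℝ))).div_atTop h3)
    simpa using this
  constructor
  · refine le_of_tendsto ((Filter.tendsto_add_atTop_iff_nat n).2 hl) (Filter.Eventually.of_forall fun k => ?_)
    induction k with
    | zero => simp
    | succ k ih =>
      rw [add_right_comm]
      exact (rr_step (k + n) (by omega)).1.trans ih
  · have : rr n - 1 / (8 * (n : ℝ) ^ 2) ≤ 0 := by
      refine ge_of_tendsto ((Filter.tendsto_add_atTop_iff_nat n).2 hl2) (Filter.Eventually.of_forall fun k => ?_)
      induction k with
      | zero => simp
      | succ k ih =>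
        rw [add_right_comm]
        exact ih.trans (rr_step (k + n) (by omega)).2
    linarith
end S8

namespace S8
open Finset


lemma harm_eq (n : ℕ) : (harmonic n : ℝ) = ∑ i ∈ Icc 1 n, 1 / (i : ℝ) := by
  rw [harmonic_eq_sum_Icc]; push_cast; simp

lemma gamma_lo : (0.57721 : ℝ) ≤ Real.eulerMascheroniConstant := by
  have h := (rr_bounds 128 (by norm_num)).1
  unfold rr at h
  have e : Real.log ((128 : ℕ) : ℝ) = 7 * Real.log 2 := by
    rw [← Real.log_rpow (by norm_num)]; norm_num
  have h2 : ((harmonic 128 : ℚ) : ℝ) ≥ ((5.4331470 : ℚ) : ℝ) := by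
    apply Rat.cast_le.2
    norm_num [harmonic, Finset.sum_range_succ]
  rw [e] at h
  have := Real.log_two_lt_d9
  push_cast at h h2
  norm_num at h h2
  linarith

lemma gamma_hi : Real.eulerMascheroniConstant ≤ (0.57722 : ℝ) := by
  have h := (rr_bounds 128 (by norm_num)).2
  unfold rr at h
  have e : Real.log ((128 : ℕ) : ℝ) = 7 * Real.log 2 := by
    rw [← Real.log_rpow (by norm_num)]; norm_num
  have h2 : ((harmonic 128 : ℚ) : ℝ) ≤ ((5.4331471 : ℚ) : ℝ) := by
    apply Rat.cast_le.2
    norm_num [harmonic, Finset.sum_range_succ]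
  rw [e] at h
  have := Real.log_two_gt_d9
  push_cast at h h2
  norm_num at h h2
  linarith

lemma EE_empty (y : ℝ) : EE ∅ y = y * ((harmonic ⌊y⌋₊ : ℝ) - Real.log y - Real.eulerMascheroniConstant) := by
  rw [harm_eq]
  simp [EE, F, PP, LL]; ring

lemma exp_lin (E z : ℝ) (hE : 0 < E) : E * (1 + z - Real.log E) ≤ Real.exp z := by
  have h := Real.add_one_le_exp (z - Real.log E)
  rw [Real.exp_sub, Real.exp_log hE, le_div_iff₀ hE] at h
  linarith

lemma EE_empty_bound (y : ℝ) (hy : 0 < y) : |EE ∅ y| ≤ Real.eulerMascheroniConstant := by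
  have g1 := gamma_lo
  have g2 := gamma_hi
  rw [EE_empty]
  by_cases h1 : y < 1
  · have : ⌊y⌋₊ = 0 := Nat.floor_eq_zero.2 h1
    rw [this]
    simp only [harmonic_zero, Rat.cast_zero]
    have hl : Real.log y ≤ 0 := Real.log_nonpos hy.le h1.le
    have h2 := Real.log_le_sub_one_of_pos (x := 1 / (y * 2)) (by positivity)
    rw [Real.log_div (by norm_num) (by positivity), Real.log_one, Real.log_mul (by positivity) (by norm_num)] at h2
    have h3 := Real.log_two_gt_d9
    have h4 := Real.log_two_lt_d9
    have h5 : y * (1 / (y * 2)) = 1 / 2 := by field_simp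
    rw [abs_le]
    constructor
    · nlinarith
    · have : y * (-Real.log y) ≤ y * (1 / (y * 2) - 1 + Real.log 2) := by
        apply mul_le_mul_of_nonneg_left _ hy.le; linarith
      have : y * (0 - Real.log y - Real.eulerMascheroniConstant) ≤ 1 / 2 + y * (-1 + Real.log 2 - Real.eulerMascheroniConstant) := by
        nlinarith
      nlinarith
  · push Not at h1
    set n := ⌊y⌋₊ with hn
    have hn1 : 1 ≤ n := by rw [hn]; exact Nat.one_le_floor_iff _ |>.2 h1
    have hny : (n : ℝ) ≤ y := Nat.floor_le hy.le
    have hny2 : y < n + 1 := Nat.lt_floor_add_one y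
    have hn1' : (1 : ℝ) ≤ n := by exact_mod_cast hn1
    obtain ⟨r1, r2⟩ := rr_bounds n hn1
    obtain ⟨r3, r4⟩ := rr_bounds (n + 1) (by omega)
    unfold rr at r1 r2 r3 r4
    rw [abs_le]
    constructor
    · rw [harmonic_succ] at r4
      push_cast at r4
      have hlog : Real.log y ≤ Real.log (n + 1) := Real.log_le_log hy hny2.le
      have e : ((n:ℝ) + 1)⁻¹ = 1 / (n + 1) := by rw [one_div]
      have k : -(1 / (2 * ((n : ℝ) + 1))) - 1 / (8 * ((n : ℝ) + 1) ^ 2) ≤ (harmonic n : ℝ) - Real.log y - Real.eulerMascheroniConstant := by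
        have : 1 / (2 * ((n : ℝ) + 1)) = (1 / (n + 1)) - (1 / (2 * ((n : ℝ) + 1))) := by field_simp; ring
        linarith
      have k2 : (1 / (2 * ((n : ℝ) + 1))) + 1 / (8 * ((n : ℝ) + 1) ^ 2) ≤ (1 / 2 + 1 / 16) / (n + 1) := by
        rw [← sub_nonneg]
        have : (1 / 2 + 1 / 16 : ℝ) / (n + 1) - ((1 / (2 * ((n : ℝ) + 1))) + 1 / (8 * ((n : ℝ) + 1) ^ 2)) = (n - 1) / (16 * (n + 1) ^ 2) := by
          field_simp; ring
        rw [this]; apply div_nonneg; linarith; positivity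
      have k3 : y * ((1 / 2 + 1 / 16) / ((n:ℝ) + 1)) ≤ 1 / 2 + 1 / 16 := by
        rw [← mul_div_assoc, div_le_iff₀ (by positivity)]; nlinarith
      have k4 := mul_le_mul_of_nonneg_left (by linarith : -((1 / 2 + 1 / 16) / ((n:ℝ) + 1)) ≤ (harmonic n : ℝ) - Real.log y - Real.eulerMascheroniConstant) hy.le
      nlinarith
    · have h6 := Real.log_le_sub_one_of_pos (x := n / y) (by positivity)
      rw [Real.log_div (by positivity) (by positivity)] at h6
      have k : (harmonic n : ℝ) - Real.log y - Real.eulerMascheroniConstant ≤ n / y - 1 + 1 / (2 * n) := by linarith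
      have k4 := mul_le_mul_of_nonneg_left k hy.le
      have e : y * ((n:ℝ) / y - 1 + 1 / (2 * n)) = n - y + y / (2 * n) := by field_simp
      have k5 : y / (2 * (n:ℝ)) ≤ 1 / 2 + (y - n) := by
        rw [div_le_iff₀ (by positivity)]; nlinarith
      linarith

lemma AA_empty (y : ℝ) : AA ∅ y = DD ⌊y⌋₊ - y * (Real.log y + (2 * Real.eulerMascheroniConstant - 1)) := by
  rw [AA, TT_empty, mm]; simp [PP, LL]

lemma AA_empty_bound_ge (t : ℝ) (h1 : 1 ≤ t) : |AA ∅ (t ^ 2)| ≤ t + 1 / 4 := by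
  have hy : (1 : ℝ) ≤ t ^ 2 := by nlinarith
  rw [AA_empty]
  have ht0 : 0 < t := by linarith
  set K := ⌊t⌋₊ with hKd
  have hK1 : 1 ≤ K := by rw [hKd]; exact Nat.one_le_floor_iff _ |>.2 h1
  have hK2 : (K : ℝ) ≤ t := Nat.floor_le ht0.le
  have hK3 : t < K + 1 := Nat.lt_floor_add_one t
  have hK1' : (1 : ℝ) ≤ K := by exact_mod_cast hK1
  set N := ⌊t ^ 2⌋₊ with hN
  have hNK : K * K ≤ N := by
    rw [hN]; apply Nat.le_floor; push_cast; nlinarith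
  have hNK2 : N < (K + 1) ^ 2 := by
    rw [hN]; apply (Nat.floor_lt (by positivity)).2; push_cast; nlinarith
  rw [DD_hyp K N hNK2]
  push_cast
  have e1 : ∀ a ∈ Icc 1 K, ((if a * a ≤ N then 2 * ((N / a : ℕ) : ℤ) + 1 - 2 * a else 0 : ℤ) : ℝ) =
      2 * (t ^ 2 * (1 / (a : ℝ))) - 2 * (t ^ 2 / a - (N / a : ℕ)) + 1 - 2 * a := by
    intro a ha
    have h := mem_Icc.1 ha
    rw [if_pos (by nlinarith)]
    simp only [Int.cast_add, Int.cast_sub, Int.cast_mul, Int.cast_natCast, Int.cast_ofNat, Int.cast_one]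
    ring
  have e3 : ∑ a ∈ Icc 1 K, ((if a * a ≤ N then 2 * ((N / a : ℕ) : ℤ) + 1 - 2 * a else 0 : ℤ) : ℝ) =
      2 * (t ^ 2 * harmonic K) - 2 * ∑ a ∈ Icc 1 K, (t ^ 2 / a - (N / a : ℕ)) - K ^ 2 := by
    rw [sum_congr rfl e1, harm_eq, mul_sum, mul_sum, mul_sum]
    have : (K : ℝ) ^ 2 = ∑ a ∈ Icc 1 K, (2 * (a : ℝ) - 1) := by
      clear * -
      induction K with
      | zero => simp
      | succ k ih => rw [Finset.sum_Icc_succ_top (by omega), ← ih]; push_cast; ring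
    rw [this, ← sum_sub_distrib, ← sum_sub_distrib]
    exact sum_congr rfl fun a _ => by ring
  set S := ∑ a ∈ Icc 1 K, (t ^ 2 / a - ((N / a : ℕ) : ℝ)) with hS
  have hfl : ∀ a : ℕ, N / a = ⌊t ^ 2 / a⌋₊ := fun a => by rw [hN, Nat.floor_div_natCast]
  have S0 : 0 ≤ S := by
    apply sum_nonneg; intro a ha
    rw [hfl]
    linarith [Nat.floor_le (show 0 ≤ t ^ 2 / (a : ℝ) by positivity)]
  have S1 : S ≤ K := by
    have : S ≤ ∑ a ∈ Icc 1 K, (1 : ℝ) := by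
      apply sum_le_sum; intro a ha
      rw [hfl]
      linarith [Nat.lt_floor_add_one (t ^ 2 / (a : ℝ))]
    simpa using this
  have e4 : ((∑ a ∈ Icc 1 K, (if a * a ≤ N then 2 * ((N / a : ℕ) : ℤ) + 1 - 2 * a else 0) : ℤ) : ℝ) = 2 * (t ^ 2 * harmonic K) - 2 * S - K ^ 2 := by
    rw [← e3]; push_cast; rfl
  push_cast at e4
  rw [e4, Real.log_pow]
  obtain ⟨r1, r2⟩ := rr_bounds K hK1
  unfold rr at r1 r2
  have hz : (1 : ℝ) ≤ t / K := by rw [le_div_iff₀] <;> linarith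
  have l1 := log_le_half _ hz
  have l2 := le_log_frac _ hz
  rw [Real.log_div (by positivity) (by positivity)] at l1 l2
  obtain ⟨f, hf⟩ : ∃ f, f = t - K := ⟨_, rfl⟩
  have hf0 : 0 ≤ f := by linarith
  have hf1 : f ≤ 1 := by linarith
  have ht : t = K + f := by linarith
  have t2 : 0 < t ^ 2 := by positivity
  rw [abs_le]
  constructor
  · have k : -((t / K - 1 / (t / K)) / 2) + 1 / (2 * K) - 1 / (8 * (K:ℝ) ^ 2) ≤ (harmonic K : ℝ) - Real.log t - Real.eulerMascheroniConstant := by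
      linarith
    have k2 := mul_le_mul_of_nonneg_left k t2.le
    have e5 : 2 * (t ^ 2 * (-((t / K - 1 / (t / K)) / 2) + 1 / (2 * K) - 1 / (8 * (K:ℝ) ^ 2))) + t ^ 2 - K ^ 2 - 2 * K + t =
        3 * f - 2 * f ^ 2 + f ^ 2 * (1 - f) / K - (t / K) ^ 2 / 4 := by
      rw [ht]; field_simp; ring
    have k3 : 0 ≤ f ^ 2 * (1 - f) / K := by
      apply div_nonneg _ (by linarith); exact mul_nonneg (sq_nonneg _) (by linarith)
    have k4 : t / K ≤ 1 + f := by
      rw [div_le_iff₀ (by linarith)]; nlinarith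
    have k5 : (t / K) ^ 2 ≤ (1 + f) ^ 2 := by gcongr
    have k6 : f ^ 2 ≤ f := by nlinarith only [hf0, hf1]
    push_cast
    linarith
  · have k : (harmonic K : ℝ) - Real.log t - Real.eulerMascheroniConstant ≤ -(2 * (t / K - 1) / (t / K + 1)) + 1 / (2 * K) := by
      linarith
    have k2 := mul_le_mul_of_nonneg_left k t2.le
    have e5 : 2 * (t ^ 2 * (-(2 * (t / K - 1) / (t / K + 1)) + 1 / (2 * K))) + t ^ 2 - K ^ 2 - t =
        f + f ^ 2 / K - 2 * f ^ 2 - f ^ 3 / (2 * K + f) := by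
      have : (2 * (K:ℝ) + f) ≠ 0 := by positivity
      have : (K:ℝ) + f + K ≠ 0 := by positivity
      have e6 : 2 * ((K + f) / K - 1) / ((K + f) / K + 1) = 2 * f / (2 * K + f) := by
        field_simp; ring
      rw [ht, e6]; field_simp; ring
    have k3 : 0 ≤ f ^ 3 / (2 * K + f) := by positivity
    have k4 : f ^ 2 / K ≤ f ^ 2 := by
      rw [div_le_iff₀ (by linarith)]; exact le_mul_of_one_le_right (sq_nonneg f) hK1'
    have k6 : f - f ^ 2 ≤ 1 / 4 := by linarith [sq_nonneg (f - 1 / 2)]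
    push_cast
    linarith

lemma AA_empty_lt (y : ℝ) (h1 : y < 1) : AA ∅ y = y * (-Real.log y - (2 * Real.eulerMascheroniConstant - 1)) := by
  rw [AA_empty, Nat.floor_eq_zero.2 h1]; simp [DD]; ring

lemma AA_empty_bound (y : ℝ) (hy : 0 < y) : |AA ∅ y| ≤ Real.sqrt y + 1 / 4 := by
  by_cases h1 : y < 1
  · rw [AA_empty_lt y h1]
    have g1 := gamma_lo
    have g2 := gamma_hi
    obtain ⟨s, hs⟩ : ∃ s, s = Real.sqrt y := ⟨_, rfl⟩
    have hs0 : 0 < s := by rw [hs]; exact Real.sqrt_pos.2 hy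
    have hsy : y = s ^ 2 := by rw [hs, Real.sq_sqrt hy.le]
    rw [← hs, hsy, Real.log_pow]
    have hs1 : s < 1 := by nlinarith
    have l1 := Real.log_nonpos hs0.le hs1.le
    have l2 := Real.log_le_sub_one_of_pos (x := 1 / (2 * s)) (by positivity)
    rw [Real.log_div (by norm_num) (by positivity), Real.log_one, Real.log_mul (by norm_num) (by positivity)] at l2
    have h4 := Real.log_two_lt_d9
    have h5 : s * (1 / (2 * s)) = 1 / 2 := by field_simp
    have l3 : s * (-Real.log s) ≤ 1 / 2 := by
      have := mul_le_mul_of_nonneg_left (show -Real.log s ≤ 1 / (2 * s) by linarith) hs0.le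
      linarith
    have l4 := mul_le_mul_of_nonneg_left l3 hs0.le
    have l5 : 0 ≤ s ^ 2 * (-Real.log s) := mul_nonneg (by positivity) (by linarith)
    rw [abs_le]; push_cast
    constructor
    · nlinarith
    · nlinarith
  · push Not at h1
    have := AA_empty_bound_ge (Real.sqrt y) (by rw [Real.one_le_sqrt]; exact h1)
    rwa [Real.sq_sqrt hy.le] at this

end S8

namespace S8
open Finset

def SC : ℕ := 18446744073709551616

def hLo (x2 : ℕ) : ℕ → ℕ → ℕ
  | 0, _ => 0
  | n + 1, i => SC / (2 * i + 1) + x2 * hLo x2 n (i + 1) / SC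

def hHi (x2 : ℕ) : ℕ → ℕ → ℕ
  | 0, _ => 0
  | n + 1, i => SC / (2 * i + 1) + x2 * hHi x2 n (i + 1) / SC + 2

/-- lower and upper bounds of `log 2` -/
def l2lo : ℕ := SC * 6931471803 / 10000000000
def l2hi : ℕ := SC * 6931471808 / 10000000000 + 1

def logLo (k : ℕ) : ℕ :=
  Nat.log2 k * l2lo + 2 * ((k - 2 ^ Nat.log2 k) * SC / (k + 2 ^ Nat.log2 k) *
    hLo ((k - 2 ^ Nat.log2 k) * SC / (k + 2 ^ Nat.log2 k) * ((k - 2 ^ Nat.log2 k) * SC / (k + 2 ^ Nat.log2 k)) / SC) 10 0 / SC)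

def logHi (k : ℕ) : ℕ :=
  Nat.log2 k * l2hi + 2 * (((k - 2 ^ Nat.log2 k) * SC / (k + 2 ^ Nat.log2 k) + 1) *
    hHi (((k - 2 ^ Nat.log2 k) * SC / (k + 2 ^ Nat.log2 k) + 1) * ((k - 2 ^ Nat.log2 k) * SC / (k + 2 ^ Nat.log2 k) + 1) / SC + 1) 10 0 / SC + 1
    + SC / 5000000000)

def sqn : ℕ → ℕ → ℕ
  | 0, x => x
  | n + 1, x => sqn n (x * x / SC)

def expPos (z : ℕ) : ℕ := sqn 24 (SC + z / 16777216)
def expNeg (z : ℕ) : ℕ := sqn 24 (SC - (z / 16777216 + 1))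

end S8

namespace S8
open Finset

/-- real value of a fixed-point number -/
noncomputable def vv (n : ℕ) : ℝ := (n : ℝ) / SC

lemma SC_pos : (0 : ℝ) < SC := by norm_num [SC]
lemma SC_npos : 0 < SC := by norm_num [SC]

lemma vv_nonneg (n : ℕ) : 0 ≤ vv n := div_nonneg (by positivity) SC_pos.le
lemma vv_add (a b : ℕ) : vv (a + b) = vv a + vv b := by unfold vv; push_cast; ring
lemma vv_mul (a b : ℕ) : vv (a * b) = a * vv b := by unfold vv; push_cast; ring
lemma vv_mono {a b : ℕ} (h : a ≤ b) : vv a ≤ vv b := by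
  unfold vv; have := SC_pos; gcongr
lemma vv_SC : vv SC = 1 := div_self SC_pos.ne'
lemma vv_div_le (a b : ℕ) : vv (a / b) ≤ vv a / b := by
  unfold vv
  rw [div_right_comm]
  have := SC_pos
  gcongr
  exact Nat.cast_div_le
lemma le_vv_div (a b : ℕ) (hb : 0 < b) : vv a / b ≤ vv (a / b) + 1 / SC := by
  unfold vv
  rw [div_right_comm, ← add_div]
  have := SC_pos
  gcongr
  rw [div_le_iff₀ (by exact_mod_cast hb)]
  have := Nat.div_add_mod a b
  have h2 := Nat.mod_lt a hb
  have : a ≤ (a / b + 1) * b := by nlinarith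
  exact_mod_cast this
lemma vv_one : vv 1 = 1 / SC := by simp [vv]
lemma le_vv_div' (a b : ℕ) (hb : 0 < b) : vv a / b ≤ vv (a / b + 1) := by
  rw [vv_add, vv_one]; exact le_vv_div a b hb
lemma vv_mulSC (a b : ℕ) : vv (a * b / SC) ≤ vv a * vv b := by
  refine (vv_div_le _ _).trans (le_of_eq ?_)
  unfold vv; push_cast; ring
lemma vv_mulSC' (a b : ℕ) : vv a * vv b ≤ vv (a * b / SC + 1) := by
  refine le_trans (le_of_eq ?_) (le_vv_div' _ _ SC_npos)
  unfold vv; push_cast; ring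
lemma vv_sub_le (a b : ℕ) (x : ℝ) (hx : 0 ≤ x) (h : vv a - vv b ≤ x) : vv (a - b) ≤ x := by
  rcases le_total a b with hab | hab
  · rw [Nat.sub_eq_zero_of_le hab]; simpa [vv] using hx
  · have : vv (a - b) + vv b = vv a := by rw [← vv_add, Nat.sub_add_cancel hab]
    linarith
lemma le_vv_sub (a b : ℕ) : vv a - vv b ≤ vv (a - b) := by
  have : vv a ≤ vv (a - b) + vv b := by rw [← vv_add]; exact vv_mono (by omega)
  linarith
lemma vv_scale (a b c : ℕ) (hc : 0 < c) : vv (SC * a / c) ≤ (a : ℝ) / c := by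
  refine (vv_div_le _ _).trans (le_of_eq ?_)
  have := SC_pos
  unfold vv; push_cast; field_simp
lemma vv_scale' (a c : ℕ) (hc : 0 < c) : (a : ℝ) / c ≤ vv (SC * a / c + 1) := by
  refine le_trans (le_of_eq ?_) (le_vv_div' _ _ hc)
  have := SC_pos
  unfold vv; push_cast; field_simp

lemma hLo_le (x2 : ℕ) (X : ℝ) (h : vv x2 ≤ X) (n i : ℕ) :
    vv (hLo x2 n i) ≤ ∑ j ∈ range n, X ^ j / (2 * ((i + j : ℕ) : ℝ) + 1) := by
  have hX : 0 ≤ X := (vv_nonneg _).trans h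
  induction n generalizing i with
  | zero => simp [hLo, vv]
  | succ n ih =>
    rw [hLo, vv_add, sum_range_succ']
    have h1 : vv (SC / (2 * i + 1)) ≤ 1 / (2 * (i : ℝ) + 1) := by
      have := vv_div_le SC (2 * i + 1)
      rw [vv_SC] at this; push_cast at this; exact this
    have h2 := (vv_mulSC x2 (hLo x2 n (i + 1))).trans (mul_le_mul h (ih (i + 1)) (vv_nonneg _) hX)
    rw [mul_sum] at h2
    have h3 : ∑ j ∈ range n, X * (X ^ j / (2 * ((i + 1 + j : ℕ) : ℝ) + 1)) =
        ∑ j ∈ range n, X ^ (j + 1) / (2 * ((i + (j + 1) : ℕ) : ℝ) + 1) :=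
      sum_congr rfl fun j _ => by rw [pow_succ']; push_cast; ring
    rw [h3] at h2
    simp only [pow_zero, add_zero]
    linarith

lemma hHi_ge (x2 : ℕ) (X : ℝ) (hX : 0 ≤ X) (h : X ≤ vv x2) (n i : ℕ) :
    ∑ j ∈ range n, X ^ j / (2 * ((i + j : ℕ) : ℝ) + 1) ≤ vv (hHi x2 n i) := by
  induction n generalizing i with
  | zero => simp [hHi, vv]
  | succ n ih =>
    have e : SC / (2 * i + 1) + x2 * hHi x2 n (i + 1) / SC + 2 = (SC / (2 * i + 1) + 1) + (x2 * hHi x2 n (i + 1) / SC + 1) := by ring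
    rw [hHi, e, vv_add, sum_range_succ']
    have h1 : 1 / (2 * (i : ℝ) + 1) ≤ vv (SC / (2 * i + 1) + 1) := by
      have := le_vv_div' SC (2 * i + 1) (by omega)
      rw [vv_SC] at this; push_cast at this; exact this
    have h2 := (mul_le_mul h (ih (i + 1)) (by positivity) (vv_nonneg _)).trans (vv_mulSC' x2 (hHi x2 n (i + 1)))
    rw [mul_sum] at h2
    have h3 : ∑ j ∈ range n, X * (X ^ j / (2 * ((i + 1 + j : ℕ) : ℝ) + 1)) =
        ∑ j ∈ range n, X ^ (j + 1) / (2 * ((i + (j + 1) : ℕ) : ℝ) + 1) :=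
      sum_congr rfl fun j _ => by rw [pow_succ']; push_cast; ring
    rw [h3] at h2
    simp only [pow_zero, add_zero]
    linarith

lemma l2lo_le : vv l2lo ≤ Real.log 2 := by
  have := vv_scale 6931471803 0 10000000000 (by norm_num)
  have h2 := Real.log_two_gt_d9
  unfold l2lo
  norm_num at this h2 ⊢
  linarith
lemma le_l2hi : Real.log 2 ≤ vv l2hi := by
  have := vv_scale' 6931471808 10000000000 (by norm_num)
  have h2 := Real.log_two_lt_d9
  unfold l2hi
  norm_num at this h2 ⊢
  linarith

lemma log_decomp (k : ℕ) (hk : 0 < k) : ∃ x : ℝ, x = ((k - 2 ^ Nat.log2 k : ℕ) : ℝ) / ((k + 2 ^ Nat.log2 k : ℕ) : ℝ) ∧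
    0 ≤ x ∧ x ≤ 1 / 3 ∧ Real.log k = Nat.log2 k * Real.log 2 + 2 * (1 / 2 * Real.log ((1 + x) / (1 - x))) := by
  refine ⟨_, rfl, by positivity, ?_, ?_⟩
  · have h1 := @Nat.lt_log2_self k
    rw [div_le_div_iff₀ (by positivity) (by norm_num)]
    rw [pow_succ] at h1
    have : (k - 2 ^ Nat.log2 k) * 3 ≤ 1 * (k + 2 ^ Nat.log2 k) := by omega
    exact_mod_cast this
  · have h1 := Nat.log2_self_le hk.ne'
    rw [Nat.cast_sub h1]
    push_cast
    set E : ℝ := 2 ^ Nat.log2 k with hE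
    have hE0 : 0 < E := by positivity
    have hk0 : (0 : ℝ) < k := by exact_mod_cast hk
    have e : (1 + ((k : ℝ) - E) / (k + E)) / (1 - ((k : ℝ) - E) / (k + E)) = k / E := by
      have a1 : 1 + ((k : ℝ) - E) / (k + E) = 2 * k / (k + E) := by field_simp; ring
      have a2 : 1 - ((k : ℝ) - E) / (k + E) = 2 * E / (k + E) := by field_simp; ring
      rw [a1, a2]; field_simp
    rw [e, Real.log_div hk0.ne' hE0.ne', hE, Real.log_pow]; ring

lemma series_rw (x : ℝ) (n : ℕ) : ∑ i ∈ range n, x ^ (2 * i + 1) / (2 * (i : ℝ) + 1) =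
    x * ∑ j ∈ range n, (x * x) ^ j / (2 * ((0 + j : ℕ) : ℝ) + 1) := by
  rw [mul_sum]
  refine sum_congr rfl fun i _ => ?_
  rw [zero_add, pow_succ, pow_mul, ← sq]; ring

lemma logLo_le (k : ℕ) (hk : 0 < k) : vv (logLo k) ≤ Real.log k := by
  obtain ⟨x, hx, hx0, hx1, hl⟩ := log_decomp k hk
  have h := Real.sum_range_le_log_div hx0 (by linarith) 10
  rw [series_rw] at h
  rw [hl, logLo, vv_add, vv_mul, vv_mul]
  set xl := (k - 2 ^ Nat.log2 k) * SC / (k + 2 ^ Nat.log2 k) with hxl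
  have h1 : vv xl ≤ x := by
    rw [hxl, mul_comm, hx]
    exact vv_scale _ 0 _ (by positivity)
  have h2 := hLo_le (xl * xl / SC) (x * x) ((vv_mulSC _ _).trans (mul_le_mul h1 h1 (vv_nonneg _) hx0)) 10 0
  have h3 := (vv_mulSC xl (hLo (xl * xl / SC) 10 0)).trans (mul_le_mul h1 h2 (vv_nonneg _) hx0)
  have h4 := mul_le_mul_of_nonneg_left l2lo_le (Nat.cast_nonneg (α := ℝ) (Nat.log2 k))
  push_cast
  linarith

lemma le_logHi (k : ℕ) (hk : 0 < k) : Real.log k ≤ vv (logHi k) := by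
  obtain ⟨x, hx, hx0, hx1, hl⟩ := log_decomp k hk
  have h := Real.log_div_le_sum_range_add hx0 (by linarith) 10
  rw [series_rw] at h
  rw [hl, logHi, vv_add, vv_mul, vv_mul]
  set xl := (k - 2 ^ Nat.log2 k) * SC / (k + 2 ^ Nat.log2 k) + 1 with hxl
  have h1 : x ≤ vv xl := by
    rw [hxl, mul_comm, hx]
    exact vv_scale' _ _ (by positivity)
  have h2 := hHi_ge (xl * xl / SC + 1) (x * x) (by positivity) ((mul_le_mul h1 h1 hx0 (vv_nonneg _)).trans (vv_mulSC' _ _)) 10 0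
  have h3 := (mul_le_mul h1 h2 (by positivity) (vv_nonneg _)).trans (vv_mulSC' xl (hHi (xl * xl / SC + 1) 10 0))
  have h4 := mul_le_mul_of_nonneg_left le_l2hi (Nat.cast_nonneg (α := ℝ) (Nat.log2 k))
  have h5 : x ^ (2 * 10 + 1) / (1 - x ^ 2) ≤ vv (SC / 5000000000) := by
    have a1 : x ^ (2 * 10 + 1) ≤ (1 / 3) ^ 21 := by gcongr
    have a2 : 8 / 9 ≤ 1 - x ^ 2 := by nlinarith
    calc x ^ (2 * 10 + 1) / (1 - x ^ 2) ≤ (1 / 3) ^ 21 / (8 / 9) := by gcongr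
      _ ≤ _ := by norm_num [vv, SC]
  push_cast
  rw [vv_add]
  linarith

lemma sqn_le (n x : ℕ) (w : ℝ) (h : vv x ≤ Real.exp w) : vv (sqn n x) ≤ Real.exp (2 ^ n * w) := by
  induction n generalizing x w with
  | zero => simpa [sqn] using h
  | succ n ih =>
    rw [sqn, pow_succ, mul_assoc]
    apply ih
    rw [two_mul, Real.exp_add]
    exact (vv_mulSC _ _).trans (mul_le_mul h h (vv_nonneg _) (Real.exp_pos _).le)

lemma expPos_le (z : ℕ) (w : ℝ) (h : vv z ≤ w) : vv (expPos z) ≤ Real.exp w := by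
  have := sqn_le 24 (SC + z / 16777216) (w / 16777216) ?_
  · unfold expPos
    have e : (2 : ℝ) ^ 24 * (w / 16777216) = w := by norm_num; ring
    rwa [e] at this
  · rw [vv_add, vv_SC]
    have h1 := vv_div_le z 16777216
    have h2 := Real.add_one_le_exp (w / 16777216)
    have : vv z / (16777216 : ℕ) ≤ w / 16777216 := by push_cast; linarith
    linarith

lemma expNeg_le (z : ℕ) (w : ℝ) (h : w ≤ vv z) : vv (expNeg z) ≤ Real.exp (-w) := by
  have := sqn_le 24 (SC - (z / 16777216 + 1)) (-w / 16777216) ?_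
  · unfold expNeg
    have e : (2 : ℝ) ^ 24 * (-w / 16777216) = -w := by norm_num; ring
    rwa [e] at this
  · apply vv_sub_le _ _ _ (Real.exp_pos _).le
    rw [vv_SC]
    have h1 := le_vv_div' z 16777216 (by norm_num)
    have h2 := Real.add_one_le_exp (-w / 16777216)
    have : w / 16777216 ≤ vv z / (16777216 : ℕ) := by push_cast; linarith
    linarith [neg_div (16777216:ℝ) w]

end S8

namespace S8
open Finset

structure Rec where
  p0 : ℕ
  minp : ℕ
  t1 : ℕ
  t2 : ℕ
  inf : Bool
  B : ℕ
  M : ℕ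
  W : ℕ
  S : ℕ
  lam : ℕ
  N : ℕ
  E1 : ℕ
  E2 : ℕ
  F1 : ℕ
  F2 : ℕ

def Dr (n : ℕ) : ℕ → ℕ
  | 0 => 0
  | K + 1 => Dr n K + (if Nat.ble ((K + 1) * (K + 1)) n then 2 * (n / (K + 1) - (K + 1)) + 1 else 0)

def Dn (n : ℕ) : ℕ := Dr n 20

def pn (p : ℕ) : ℕ := if Nat.beq p 0 then 1 else (p - 1) * (p - 1)
def pd (p : ℕ) : ℕ := if Nat.beq p 0 then 1 else p * p
def aLo (p : ℕ) : ℕ := SC * 15442 / 100000 + (if Nat.beq p 0 then 0 else 2 * logLo p / (p - 1))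
def aHi (p : ℕ) : ℕ := SC * 15444 / 100000 + 1 + (if Nat.beq p 0 then 0 else 2 * logHi p / (p - 1) + 1)

/-- lower bound for log (k/4), `k ≥ 4` -/
def qLo (k : ℕ) : ℕ := logLo k - 2 * l2hi
def qHi (k : ℕ) : ℕ := logHi k - 2 * l2lo

def rhs (r : Rec) (k : ℕ) : ℕ := r.B * expPos (r.t1 * qLo k / 10000) + r.M * expPos (qLo k / 2)

/-- cell `[k/4, k'/4)` -/
def cell (r : Rec) (k k' al ah : ℕ) : Bool :=
  Nat.ble (4 * pd r.p0 * SC * 10000 * (Dn ((k' - 1) / 4) + Dn ((k' - 1) / 4 / r.p0 / r.p0)))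
    (8 * pd r.p0 * SC * 10000 * Dn ((k' - 1) / 4 / r.p0) + 10000 * pn r.p0 * k * (qLo k + al)
      + 4 * pd r.p0 * rhs r k) &&
  Nat.ble (10000 * pn r.p0 * k' * (qHi k' + ah) + 8 * pd r.p0 * SC * 10000 * Dn (k / 4 / r.p0))
    (4 * pd r.p0 * SC * 10000 * (Dn (k / 4) + Dn (k / 4 / r.p0 / r.p0)) + 4 * pd r.p0 * rhs r k)

def stp (k : ℕ) : ℕ := if Nat.ble k 15 then 1 else if Nat.ble k 47 then 2 else if Nat.ble k 399 then 4
  else if Nat.ble k 1199 then 8 else 16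

def cells (r : Rec) (al ah : ℕ) : ℕ → ℕ → Bool
  | 0, _ => false
  | n + 1, k => Nat.ble (4 * r.N) k || (cell r k (k + stp k) al ah && cells r al ah n (k + stp k))

/-- upper bound for `2^20 p^(-1/2)` -/
def Uinv (p : ℕ) : ℕ := if Nat.beq p 0 then 0 else 1048576 * SC / expPos (logLo p / 2) + 1
/-- lower bound for `2^20 p^(-t2)` -/
def Winv (r : Rec) (p : ℕ) : ℕ :=
  if r.inf || Nat.beq p 0 then 0 else expNeg (r.t2 * logHi p / 10000 + 1) * 1048576 / SC

def tail (r : Rec) : Bool :=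
  Nat.ble (((1048576 + Uinv r.p0) * (1048576 + Uinv r.p0) + 1048576 * Uinv r.N) * 10000 * SC)
    (1048576 * 1048576 * (r.B * expPos ((r.t1 - 5000) * logLo r.N / 10000) + r.M * SC))

def zz (E : ℕ) : ℤ := E * ((SC : ℤ) - logHi E + logLo 10000)
def head (r : Rec) (B' : ℕ) : Bool :=
  decide (0 ≤ (pn r.p0 * aLo r.p0 : ℤ) * 100000000 + pd r.p0 * (B' * zz r.E1 + r.M * zz r.E2)) &&
  decide (pn r.p0 * 2000000000000 ≤ (pd r.p0 : ℤ) * (2 * B' * r.E1 * (10000 - r.t2) + r.M * r.E2 * 10000)) &&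
  decide ((pn r.p0 * aHi r.p0 : ℤ) * 100000000 ≤ pd r.p0 * (B' * zz r.F1 + r.M * zz r.F2)) &&
  decide (-(pn r.p0 * 2000000000000 : ℤ) ≤ (pd r.p0 : ℤ) * (2 * B' * r.F1 * (10000 - r.t2) + r.M * r.F2 * 10000))

def plist : List ℕ := [2, 3, 5, 7, 11, 13, 17, 19, 23, 29, 31, 37, 41, 43, 47, 53, 59, 61, 67, 71, 73, 79,
  83, 89, 97, 101, 103, 107, 109, 113, 127, 131, 137, 139, 149, 151, 157, 163, 167, 173, 179, 181, 191, 193,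
  197, 199, 211, 223, 227, 229, 233, 239, 241, 251, 257, 263, 269, 271, 277, 281, 283, 293, 307, 311, 313,
  317, 331, 337, 347, 349, 353, 359, 367, 373, 379, 383, 389, 397]

/-- upper bound for `10000 * max 0 h_p` -/
def hp (r : Rec) (p : ℕ) : ℕ :=
  20000 * (logHi (1048576 + Uinv p) - 20 * l2lo) -
    (2 * r.lam * (logLo (1048576 + Winv r p) - 20 * l2hi) + (10000 - r.lam) * (logLo (2 * p - 2) - logHi p))

def hsum (r : Rec) : List ℕ → ℕ
  | [] => 0
  | p :: l => (if Nat.ble r.minp p then hp r p else 0) + hsum r l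

def amgm (r : Rec) : Bool :=
  Nat.ble (r.lam * logHi r.lam + (10000 - r.lam) * logHi (10000 - r.lam) + 10000 * logHi r.M + hsum r plist)
    (r.lam * logLo r.W + (10000 - r.lam) * logLo r.S + 10000 * logLo 10000
      + (r.lam * r.t1 / 10000 - 5000) * logLo 3)

def side (r : Rec) : Bool :=
  Nat.ble 50000000 (r.lam * r.t1) && Nat.ble r.lam 8475 && Nat.ble 1 r.lam && Nat.ble 1 r.M && Nat.ble 1 r.W && Nat.ble 1 r.S
  && Nat.ble 1 r.E1 && Nat.ble 1 r.E2 && Nat.ble 1 r.F1 && Nat.ble 1 r.F2 && Nat.ble r.N 400 && Nat.ble 1 r.N &&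
  Nat.ble 5000 r.t1 && Nat.ble ((r.B + r.W) * 10 * 1048576 * 1048576) (84556 * ((1048576 + Winv r r.p0) * (1048576 + Winv r r.p0)))
  && (if Nat.beq r.p0 0 then Nat.ble (r.S * 10) 42278 else Nat.ble (r.S * 10 * r.p0) (42278 * (2 * r.p0 - 2)))
  && Nat.ble r.minp 400

def chk (r : Rec) : Bool := side r && head r (if r.inf then 0 else r.B) && tail r && cells r (aLo r.p0) (aHi r.p0) 400 4 && amgm r

end S8

namespace S8
open Finset


lemma Dr_eq (n K : ℕ) : ((Dr n K : ℕ) : ℤ) = ∑ a ∈ Icc 1 K, (if a * a ≤ n then 2 * ((n / a : ℕ) : ℤ) + 1 - 2 * a else 0) := by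
  induction K with
  | zero => simp [Dr]
  | succ K ih =>
    rw [Dr, Finset.sum_Icc_succ_top (by omega), Nat.cast_add, ih]
    congr 1
    simp only [Nat.ble_eq]
    split_ifs with h
    · have h2 : K + 1 ≤ n / (K + 1) := (Nat.le_div_iff_mul_le (by omega)).2 h
      rw [Nat.cast_add, Nat.cast_mul, Nat.cast_sub h2]
      simp only [Nat.cast_add, Nat.cast_one, Nat.cast_ofNat]
      ring
    · simp

lemma Dn_eq (n : ℕ) (hn : n < 441) : DD n = Dn n := by
  rw [DD_hyp 20 n (by norm_num; exact hn), ← Dr_eq, Dn]; simp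

def s0 (p : ℕ) : Finset ℕ := if p = 0 then ∅ else {p}

lemma s0_prime (p : ℕ) (hp : p = 0 ∨ p.Prime) : ∀ r ∈ s0 p, r.Prime := by
  intro r hr
  unfold s0 at hr
  split_ifs at hr with h
  · simp at hr
  · rw [mem_singleton] at hr; subst hr; tauto

noncomputable def ac (p : ℕ) : ℝ := 2 * Real.eulerMascheroniConstant - 1 + 2 * (Real.log p / ((p : ℝ) - 1))
noncomputable def pq (p : ℕ) : ℝ := (pn p : ℝ) / pd p

lemma pd_pos (p : ℕ) : 0 < pd p := by
  unfold pd
  split_ifs with h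
  · norm_num
  · simp at h; positivity

lemma TT_s0 (p : ℕ) (hp : p = 0 ∨ p.Prime) (y : ℝ) : TT (s0 p) y = DD ⌊y⌋₊ - 2 * DD (⌊y⌋₊ / p) + DD (⌊y⌋₊ / p / p) := by
  rcases hp with rfl | hp
  · simp [s0, TT_empty]; simp [DD]
  · have e : s0 p = insert p ∅ := by rw [s0, if_neg hp.ne_zero]; rfl
    rw [e, TT_insert ∅ p hp (by simp) (by simp), TT_empty, TT_empty, TT_empty]
    simp only [Nat.floor_div_natCast]

lemma mm_s0 (p : ℕ) (hp : p = 0 ∨ p.Prime) (y : ℝ) : mm (s0 p) y = pq p * (y * (Real.log y + ac p)) := by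
  rcases hp with rfl | hp
  · simp [mm, s0, pq, pn, pd, ac, PP, LL]
  · have h0 : p ≠ 0 := hp.ne_zero
    have h1 : (p : ℝ) ≠ 0 := by positivity
    have h2 : pq p = (1 - 1 / (p : ℝ)) ^ 2 := by
      have : 1 ≤ p := hp.one_lt.le
      simp only [pq, pn, pd, Nat.beq_eq, h0, if_false]
      push_cast [this]
      field_simp
    simp only [mm, s0, h0, if_false, PP, LL, prod_singleton, sum_singleton, h2, ac]
    ring

lemma TT_mono (s : Finset ℕ) {x y : ℝ} (h : x ≤ y) : TT s x ≤ TT s y := by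
  unfold TT
  apply sum_le_sum_of_subset_of_nonneg
  · exact Icc_subset_Icc le_rfl (Nat.floor_le_floor h)
  · intro i _ _
    unfold F
    split_ifs <;> simp

lemma ac_bounds (p : ℕ) (hp : p = 0 ∨ p.Prime) : vv (aLo p) ≤ ac p ∧ ac p ≤ vv (aHi p) := by
  have g1 := gamma_lo
  have g2 := gamma_hi
  have k1 := vv_scale 15442 0 100000 (by norm_num)
  have k2 := vv_scale' 15444 100000 (by norm_num)
  rcases hp with rfl | hp
  · simp only [ac, aLo, aHi, Nat.beq_eq, if_true, Nat.add_zero]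
    norm_num at k1 k2 ⊢
    constructor <;> linarith
  · have h0 : p ≠ 0 := hp.ne_zero
    have h1 : 1 < p := hp.one_lt
    simp only [ac, aLo, aHi, Nat.beq_eq, h0, if_false]
    rw [vv_add, vv_add]
    have m1 := vv_div_le (2 * logLo p) (p - 1)
    have m2 := le_vv_div' (2 * logHi p) (p - 1) (by omega)
    rw [vv_mul] at m1 m2
    have h2 : ((p - 1 : ℕ) : ℝ) = p - 1 := by push_cast [h1.le]; ring
    rw [h2] at m1 m2
    have hp1 : (0 : ℝ) < p - 1 := by have : (1 : ℝ) < p := by exact_mod_cast h1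
                                     linarith
    have n1 := logLo_le p (by omega)
    have n2 := le_logHi p (by omega)
    have n3 : ((2 : ℕ) : ℝ) * vv (logLo p) / (p - 1) ≤ 2 * (Real.log p / (p - 1)) := by
      rw [← mul_div_assoc]; push_cast; gcongr
    have n4 : 2 * (Real.log p / (p - 1)) ≤ ((2 : ℕ) : ℝ) * vv (logHi p) / (p - 1) := by
      rw [← mul_div_assoc]; push_cast; gcongr
    norm_num at k1 k2 ⊢
    norm_num at m1 m2 n3 n4
    constructor <;> linarith

lemma ac_nonneg (p : ℕ) (hp : p = 0 ∨ p.Prime) : 0 ≤ ac p := (vv_nonneg _).trans (ac_bounds p hp).1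

lemma qLo_le (k : ℕ) (hk : 4 ≤ k) : vv (qLo k) ≤ Real.log ((k : ℝ) / 4) := by
  have hk' : (4 : ℝ) ≤ k := by exact_mod_cast hk
  unfold qLo
  have h4 : Real.log 4 = 2 * Real.log 2 := by
    rw [show (4 : ℝ) = 2 ^ 2 by norm_num, Real.log_pow]; norm_num
  apply vv_sub_le
  · apply Real.log_nonneg; linarith
  · rw [Real.log_div (by positivity) (by norm_num), h4, vv_mul]
    have := logLo_le k (by omega)
    have := le_l2hi
    push_cast; linarith

lemma le_qHi (k : ℕ) (hk : 0 < k) : Real.log ((k : ℝ) / 4) ≤ vv (qHi k) := by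
  have hk' : (0 : ℝ) < k := by exact_mod_cast hk
  unfold qHi
  have h4 : Real.log 4 = 2 * Real.log 2 := by
    rw [show (4 : ℝ) = 2 ^ 2 by norm_num, Real.log_pow]; norm_num
  refine le_trans ?_ (le_vv_sub _ _)
  rw [Real.log_div (by positivity) (by norm_num), h4, vv_mul]
  have := le_logHi k hk
  have := l2lo_le
  push_cast; linarith

lemma rhs_le (r : Rec) (k : ℕ) (hk : 4 ≤ k) (θ y : ℝ) (h1 : (r.t1 : ℝ) / 10000 ≤ θ) (hy : (k : ℝ) / 4 ≤ y) :
    vv (rhs r k) ≤ r.B * y ^ θ + r.M * y ^ (1 / 2 : ℝ) := by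
  have hk' : (4 : ℝ) ≤ k := by exact_mod_cast hk
  have hk1 : 1 ≤ (k : ℝ) / 4 := by linarith
  have hl := Real.log_nonneg hk1
  have hq := qLo_le k hk
  have hly : Real.log ((k : ℝ) / 4) ≤ Real.log y := Real.log_le_log (by linarith) hy
  unfold rhs
  rw [vv_add, vv_mul, vv_mul]
  have hy0 : 0 < y := by linarith
  have ht : (0 : ℝ) ≤ (r.t1 : ℝ) / 10000 := by positivity
  gcongr
  · rw [Real.rpow_def_of_pos hy0]
    apply expPos_le
    refine (vv_div_le _ _).trans ?_
    rw [vv_mul]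
    push_cast
    calc (r.t1 : ℝ) * vv (qLo k) / 10000 = r.t1 / 10000 * vv (qLo k) := by ring
      _ ≤ θ * Real.log y := by
        apply mul_le_mul h1 (hq.trans hly) (vv_nonneg _) (by linarith)
      _ = _ := mul_comm _ _
  · rw [Real.rpow_def_of_pos hy0]
    apply expPos_le
    refine (vv_div_le _ _).trans ?_
    push_cast
    linarith

lemma mm_mono (p : ℕ) (hp : p = 0 ∨ p.Prime) {x y : ℝ} (hx : 1 ≤ x) (h : x ≤ y) : 
    pq p * (x * (Real.log x + ac p)) ≤ pq p * (y * (Real.log y + ac p)) := by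
  have := ac_nonneg p hp
  have h1 := Real.log_nonneg hx
  have h2 := Real.log_le_log (by linarith) h
  have : 0 ≤ pq p := by unfold pq; positivity
  have hx0 : 0 ≤ x := by linarith
  have hy0 : 0 ≤ y := by linarith
  gcongr

lemma pq_nonneg (p : ℕ) : 0 ≤ pq p := by unfold pq; positivity

lemma pq_mono (p : ℕ) (y a b : ℝ) (hy : 0 ≤ y) (h : a ≤ b) : pq p * (y * a) ≤ pq p * (y * b) := by
  have := pq_nonneg p
  gcongr

lemma cell_ok (r : Rec) (hp : r.p0 = 0 ∨ r.p0.Prime) (k k' : ℕ) (hk : 4 ≤ k) (hkk : k < k') (hk' : k' ≤ 1700)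
    (hc : cell r k k' (aLo r.p0) (aHi r.p0) = true) (θ y : ℝ) (h1 : (r.t1 : ℝ) / 10000 ≤ θ) (hy : (k : ℝ) / 4 ≤ y)
    (hy' : y < (k' : ℝ) / 4) :
    |AA (s0 r.p0) y| ≤ (r.B : ℝ) / 10000 * y ^ θ + (r.M : ℝ) / 10000 * y ^ (1 / 2 : ℝ) := by
  have hk4 : (4 : ℝ) ≤ k := by exact_mod_cast hk
  have hr := rhs_le r k hk θ y h1 hy
  unfold cell at hc
  rw [Bool.and_eq_true, Nat.ble_eq, Nat.ble_eq] at hc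
  obtain ⟨c1, c2⟩ := hc
  obtain ⟨al, ah⟩ := ac_bounds r.p0 hp
  have hq := qLo_le k hk
  have hq' := le_qHi k' (by omega)
  have c1' := vv_mono c1
  have c2' := vv_mono c2
  have hpd : (0 : ℝ) < pd r.p0 := by exact_mod_cast pd_pos _
  have hSC := SC_pos
  -- TT bounds
  have hy0 : 0 ≤ y := by linarith
  have T1 : TT (s0 r.p0) y ≤ TT (s0 r.p0) (((k' - 1) / 4 : ℕ) : ℝ) := by
    have : TT (s0 r.p0) y = TT (s0 r.p0) (⌊y⌋₊ : ℝ) := by unfold TT; rw [Nat.floor_natCast]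
    rw [this]
    apply TT_mono
    have : ⌊y⌋₊ ≤ (k' - 1) / 4 := by
      rw [Nat.le_div_iff_mul_le (by norm_num)]
      have h3 := Nat.floor_le hy0
      have : ((⌊y⌋₊ * 4 : ℕ) : ℝ) < k' := by push_cast; linarith
      have : ⌊y⌋₊ * 4 < k' := by exact_mod_cast this
      omega
    exact_mod_cast this
  have T2 : TT (s0 r.p0) ((k / 4 : ℕ) : ℝ) ≤ TT (s0 r.p0) y := by
    apply TT_mono
    refine le_trans ?_ hy
    exact Nat.cast_div_le
  rw [TT_s0 _ hp (((k' - 1) / 4 : ℕ) : ℝ), Nat.floor_natCast] at T1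
  rw [TT_s0 _ hp ((k / 4 : ℕ) : ℝ), Nat.floor_natCast] at T2
  have lt1 : (k' - 1) / 4 < 441 := by omega
  have lt2 : k / 4 < 441 := by omega
  have dl : ∀ a b : ℕ, a < 441 → a / b < 441 := fun a b h => (Nat.div_le_self a b).trans_lt h
  rw [Dn_eq _ lt1, Dn_eq _ (dl _ _ lt1), Dn_eq _ (dl _ _ (dl _ _ lt1))] at T1
  rw [Dn_eq _ lt2, Dn_eq _ (dl _ _ lt2), Dn_eq _ (dl _ _ (dl _ _ lt2))] at T2
  have m1 := mm_mono r.p0 hp (by linarith) hy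
  have m2 := mm_mono r.p0 hp (by linarith) hy'.le
  rw [AA, mm_s0 _ hp]
  -- main inequalities
  have e1 : pq r.p0 * ((k : ℝ) / 4 * (vv (qLo k) + vv (aLo r.p0))) ≤ pq r.p0 * ((k : ℝ) / 4 * (Real.log ((k : ℝ) / 4) + ac r.p0)) := by
    exact pq_mono _ _ _ _ (by clear c1 c2 c1' c2'; linarith) (by clear c1 c2 c1' c2'; linarith)
  have e2 : pq r.p0 * ((k' : ℝ) / 4 * (Real.log ((k' : ℝ) / 4) + ac r.p0)) ≤ pq r.p0 * ((k' : ℝ) / 4 * (vv (qHi k') + vv (aHi r.p0))) := by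
    exact pq_mono _ _ _ _ (by clear c1 c2 c1' c2'; linarith) (by clear c1 c2 c1' c2'; linarith)
  have f1 : (Dn ((k' - 1) / 4) : ℝ) - 2 * Dn ((k' - 1) / 4 / r.p0) + Dn ((k' - 1) / 4 / r.p0 / r.p0) ≤
      pq r.p0 * ((k : ℝ) / 4 * (vv (qLo k) + vv (aLo r.p0))) + vv (rhs r k) / 10000 := by
    rw [← vv_add]
    unfold vv at c1' ⊢
    unfold pq
    rw [div_le_div_iff_of_pos_right hSC] at c1'
    rw [← sub_nonneg]
    have : (pn r.p0 : ℝ) / pd r.p0 * ((k : ℝ) / 4 * (((qLo k + aLo r.p0 : ℕ) : ℝ) / SC)) + ((rhs r k : ℕ) : ℝ) / SC / 10000 -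
       ((Dn ((k' - 1) / 4) : ℝ) - 2 * Dn ((k' - 1) / 4 / r.p0) + Dn ((k' - 1) / 4 / r.p0 / r.p0)) =
       ((((8 * pd r.p0 * SC * 10000 * Dn ((k' - 1) / 4 / r.p0) + 10000 * pn r.p0 * k * (qLo k + aLo r.p0)
      + 4 * pd r.p0 * rhs r k : ℕ)) : ℝ) - ((4 * pd r.p0 * SC * 10000 * (Dn ((k' - 1) / 4) + Dn ((k' - 1) / 4 / r.p0 / r.p0)) : ℕ) : ℝ)) / (4 * pd r.p0 * SC * 10000) := by
      push_cast; field_simp; ring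
    rw [this]
    exact div_nonneg (by linarith) (by positivity)
  have f2 : pq r.p0 * ((k' : ℝ) / 4 * (vv (qHi k') + vv (aHi r.p0))) ≤ 
      (Dn (k / 4) : ℝ) - 2 * Dn (k / 4 / r.p0) + Dn (k / 4 / r.p0 / r.p0) + vv (rhs r k) / 10000 := by
    rw [← vv_add]
    unfold vv at c2' ⊢
    unfold pq
    rw [div_le_div_iff_of_pos_right hSC] at c2'
    rw [← sub_nonneg]
    have : (Dn (k / 4) : ℝ) - 2 * Dn (k / 4 / r.p0) + Dn (k / 4 / r.p0 / r.p0) + ((rhs r k : ℕ) : ℝ) / SC / 10000 - (pn r.p0 : ℝ) / pd r.p0 * ((k' : ℝ) / 4 * (((qHi k' + aHi r.p0 : ℕ) : ℝ) / SC)) =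
       (((4 * pd r.p0 * SC * 10000 * (Dn (k / 4) + Dn (k / 4 / r.p0 / r.p0)) + 4 * pd r.p0 * rhs r k : ℕ) : ℝ)
        - ((10000 * pn r.p0 * k' * (qHi k' + aHi r.p0) + 8 * pd r.p0 * SC * 10000 * Dn (k / 4 / r.p0) : ℕ) : ℝ)) / (4 * pd r.p0 * SC * 10000) := by
      push_cast; field_simp; ring
    rw [this]
    exact div_nonneg (by linarith) (by positivity)
  clear c1 c2 c1' c2'
  rw [abs_le]
  constructor <;> linarith

lemma stp_pos (k : ℕ) : 1 ≤ stp k ∧ stp k ≤ 16 := by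
  unfold stp; split_ifs <;> omega

lemma cells_ok (r : Rec) (hp : r.p0 = 0 ∨ r.p0.Prime) (hN : r.N ≤ 400) (θ : ℝ) (h1 : (r.t1 : ℝ) / 10000 ≤ θ) (n k : ℕ) (hk : 4 ≤ k)
    (hc : cells r (aLo r.p0) (aHi r.p0) n k = true) (y : ℝ) (hy : (k : ℝ) / 4 ≤ y) (hyN : y < r.N) :
    |AA (s0 r.p0) y| ≤ (r.B : ℝ) / 10000 * y ^ θ + (r.M : ℝ) / 10000 * y ^ (1 / 2 : ℝ) := by
  induction n generalizing k with
  | zero => simp [cells] at hc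
  | succ n ih =>
    rw [cells, Bool.or_eq_true, Bool.and_eq_true, Nat.ble_eq] at hc
    obtain ⟨s1, s2⟩ := stp_pos k
    have hkN : (k : ℝ) < 4 * r.N := by linarith
    have hkN' : k < 4 * r.N := by exact_mod_cast hkN
    rcases hc with hc | ⟨hc, hd⟩
    · omega
    · by_cases h : y < ((k + stp k : ℕ) : ℝ) / 4
      · exact cell_ok r hp k _ hk (by omega) (by omega) hc θ y h1 hy h
      · push Not at h
        exact ih (k + stp k) (by omega) hd h
end S8

namespace S8
open Finset

lemma expL (E : ℕ) (hE : 1 ≤ E) (z : ℝ) : (zz E : ℝ) / SC / 10000 + E / 10000 * z ≤ Real.exp z := by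
  have hE' : (1 : ℝ) ≤ E := by exact_mod_cast hE
  have h := exp_lin ((E : ℝ) / 10000) z (by positivity)
  refine le_trans ?_ h
  rw [Real.log_div (by positivity) (by norm_num)]
  have a := le_logHi E hE
  have b := logLo_le 10000 (by norm_num)
  have e : (zz E : ℝ) / SC = E * (1 - vv (logHi E) + vv (logLo 10000)) := by
    have := SC_pos
    unfold zz vv
    generalize logLo 10000 = l at *
    push_cast
    field_simp
  rw [e]
  push_cast at b
  have : (E : ℝ) * (1 - vv (logHi E) + vv (logLo 10000)) ≤ E * (1 - Real.log E + Real.log 10000) := by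
    gcongr
  linarith

lemma lin_aux (pn pd a c1 s1 u A : ℝ) (hpd : 0 < pd) (hu : 0 ≤ u) (hc : 0 ≤ pn * a + pd * c1) (hs : pn ≤ pd * s1)
    (hA : c1 + s1 * u ≤ A) : pn / pd * (u - a) ≤ A := by
  rw [div_mul_eq_mul_div, div_le_iff₀ hpd]
  nlinarith [mul_le_mul_of_nonneg_right hs hu, mul_le_mul_of_nonneg_right hA hpd.le]

lemma rpow_u (y u : ℝ) (hy : 0 < y) (hu : u = - Real.log y) (θ : ℝ) : y ^ θ = y * Real.exp ((1 - θ) * u) := by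
  nth_rw 2 [← Real.exp_log hy]
  rw [Real.rpow_def_of_pos hy, ← Real.exp_add, hu]
  apply congrArg
  ring

lemma head_cast (a b c d e f g h i j k : ℕ) (z1 z2 w1 w2 : ℤ) 
    (c1 : 0 ≤ (a * b : ℤ) * 100000000 + c * (d * z1 + e * z2))
    (c2 : a * 2000000000000 ≤ (c : ℤ) * (2 * d * f * (10000 - g) + e * h * 10000))
    (c3 : (a * i : ℤ) * 100000000 ≤ c * (d * w1 + e * w2))
    (c4 : -(a * 2000000000000 : ℤ) ≤ (c : ℤ) * (2 * d * j * (10000 - g) + e * k * 10000)) :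
    0 ≤ (a * b : ℝ) * 100000000 + c * (d * z1 + e * z2) ∧
    a * 2000000000000 ≤ (c : ℝ) * (2 * d * f * (10000 - g) + e * h * 10000) ∧
    (a * i : ℝ) * 100000000 ≤ c * (d * w1 + e * w2) ∧
    -(a * 2000000000000 : ℝ) ≤ (c : ℝ) * (2 * d * j * (10000 - g) + e * k * 10000) := by
  have c1 := (Int.cast_le (R := ℝ)).2 c1
  have c2 := (Int.cast_le (R := ℝ)).2 c2
  have c3 := (Int.cast_le (R := ℝ)).2 c3
  have c4 := (Int.cast_le (R := ℝ)).2 c4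
  push_cast at c1 c2 c3 c4
  exact ⟨c1, c2, c3, c4⟩

lemma head_dec (r : Rec) (B' : ℕ) (h : head r B' = true) :
    (0 : ℝ) ≤ ((pn r.p0 : ℝ) * aLo r.p0) * 100000000 + pd r.p0 * (B' * zz r.E1 + r.M * zz r.E2) ∧
    (pn r.p0 : ℝ) * 2000000000000 ≤ (pd r.p0 : ℝ) * (2 * B' * r.E1 * (10000 - r.t2) + r.M * r.E2 * 10000) ∧
    ((pn r.p0 : ℝ) * aHi r.p0) * 100000000 ≤ pd r.p0 * (B' * zz r.F1 + r.M * zz r.F2) ∧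
    -((pn r.p0 : ℝ) * 2000000000000) ≤ (pd r.p0 : ℝ) * (2 * B' * r.F1 * (10000 - r.t2) + r.M * r.F2 * 10000) := by
  unfold head at h
  rw [Bool.and_eq_true, Bool.and_eq_true, Bool.and_eq_true] at h
  exact head_cast _ _ _ _ _ _ _ _ _ _ _ _ _ _ _ (of_decide_eq_true h.1.1.1) (of_decide_eq_true h.1.1.2) (of_decide_eq_true h.1.2) (of_decide_eq_true h.2)

lemma head_ok (r : Rec) (hp : r.p0 = 0 ∨ r.p0.Prime) (B' : ℕ) (h : head r B' = true)
    (e1 : 1 ≤ r.E1) (e2 : 1 ≤ r.E2) (f1 : 1 ≤ r.F1) (f2 : 1 ≤ r.F2) (θ : ℝ)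
    (hB : B' = 0 ∨ (B' = r.B ∧ θ ≤ (r.t2 : ℝ) / 10000)) (y : ℝ) (hy : 0 < y) (hy1 : y < 1) :
    |AA (s0 r.p0) y| ≤ (r.B : ℝ) / 10000 * y ^ θ + (r.M : ℝ) / 10000 * y ^ (1 / 2 : ℝ) := by
  obtain ⟨u, hu⟩ : ∃ u, u = - Real.log y := ⟨_, rfl⟩
  have hu0 : 0 ≤ u := by rw [hu]; linarith [Real.log_nonpos hy.le hy1.le]
  have TT0 : TT (s0 r.p0) y = 0 := by
    unfold TT
    rw [Nat.floor_eq_zero.2 hy1]; simp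
  have y1 := rpow_u y u hy hu θ
  have y2 := rpow_u y u hy hu (1 / 2)
  rw [show (1 - 1 / 2 : ℝ) * u = u / 2 by ring] at y2
  obtain ⟨al, ah⟩ := ac_bounds r.p0 hp
  have hpd : (0 : ℝ) < pd r.p0 := by exact_mod_cast pd_pos _
  have hpn : (0 : ℝ) ≤ pn r.p0 := by positivity
  have hSC := SC_pos
  have key : ∀ E1 E2 : ℕ, 1 ≤ E1 → 1 ≤ E2 → ((B' : ℝ) * zz E1 + r.M * zz E2) / SC / 100000000 +
      (2 * B' * E1 * (10000 - r.t2) + r.M * E2 * 10000) / 2000000000000 * u ≤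
      (r.B : ℝ) / 10000 * Real.exp ((1 - θ) * u) + (r.M : ℝ) / 10000 * Real.exp (u / 2) := by
    intro E1 E2 h1 h2
    have k2 := mul_le_mul_of_nonneg_left (expL E2 h2 (u / 2)) (show (0 : ℝ) ≤ (r.M : ℝ) / 10000 by positivity)
    have k1 : (B' : ℝ) / 10000 * ((zz E1 : ℝ) / SC / 10000 + E1 / 10000 * ((1 - (r.t2 : ℝ) / 10000) * u)) ≤
        (r.B : ℝ) / 10000 * Real.exp ((1 - θ) * u) := by
      rcases hB with rfl | ⟨rfl, ht⟩
      · simp; positivity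
      · refine mul_le_mul_of_nonneg_left ((expL E1 h1 _).trans ?_) (by positivity)
        apply Real.exp_le_exp.2
        apply mul_le_mul_of_nonneg_right _ hu0
        linarith
    refine le_trans (le_of_eq ?_) (add_le_add k1 k2)
    field_simp
    ring
  have kE := key r.E1 r.E2 e1 e2
  have kF := key r.F1 r.F2 f1 f2
  obtain ⟨c1', c2', c3', c4'⟩ := head_dec r B' h
  clear h
  have al2 := mul_le_mul_of_nonneg_left al hpn
  have ah2 := mul_le_mul_of_nonneg_left ah hpn
  have d1 : (0 : ℝ) ≤ pn r.p0 * vv (aLo r.p0) + pd r.p0 * (((B' : ℝ) * zz r.E1 + r.M * zz r.E2) / SC / 100000000) := by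
    have : (pn r.p0 : ℝ) * vv (aLo r.p0) + pd r.p0 * (((B' : ℝ) * zz r.E1 + r.M * zz r.E2) / SC / 100000000) =
      (((pn r.p0 : ℝ) * aLo r.p0) * 100000000 + pd r.p0 * (B' * zz r.E1 + r.M * zz r.E2)) / (SC * 100000000) := by
      unfold vv; field_simp
    rw [this]; exact div_nonneg c1' (by positivity)
  have d3 : (0 : ℝ) ≤ pd r.p0 * (((B' : ℝ) * zz r.F1 + r.M * zz r.F2) / SC / 100000000) - pn r.p0 * vv (aHi r.p0) := by
    have : pd r.p0 * (((B' : ℝ) * zz r.F1 + r.M * zz r.F2) / SC / 100000000) - (pn r.p0 : ℝ) * vv (aHi r.p0) =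
      (pd r.p0 * (B' * zz r.F1 + r.M * zz r.F2) - ((pn r.p0 : ℝ) * aHi r.p0) * 100000000) / (SC * 100000000) := by
      unfold vv; field_simp
    rw [this]; exact div_nonneg (by linarith) (by positivity)
  have g1 := lin_aux (pn r.p0) (pd r.p0) (ac r.p0) _ _ u _ hpd hu0 (by linarith) (by linarith) kE
  have g2 := lin_aux (-(pn r.p0)) (pd r.p0) (ac r.p0) _ _ u _ hpd hu0 (by linarith) (by linarith) kF
  rw [AA, TT0, mm_s0 _ hp, y1, y2]
  have e : (0 : ℝ) - pq r.p0 * (y * (Real.log y + ac r.p0)) = y * (pn r.p0 / pd r.p0 * (u - ac r.p0)) := by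
    rw [hu, pq]; ring
  rw [e, abs_mul, abs_of_pos hy]
  have e3 : (r.B : ℝ) / 10000 * (y * Real.exp ((1 - θ) * u)) + (r.M : ℝ) / 10000 * (y * Real.exp (u / 2)) =
    y * ((r.B : ℝ) / 10000 * Real.exp ((1 - θ) * u) + (r.M : ℝ) / 10000 * Real.exp (u / 2)) := by ring
  rw [e3]
  apply mul_le_mul_of_nonneg_left _ hy.le
  rw [abs_le]
  constructor
  · rw [neg_div, neg_mul] at g2; linarith
  · exact g1
end S8

namespace S8
open Finset

lemma sqn_ge (n x : ℕ) (h : SC ≤ x) : SC ≤ sqn n x := by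
  induction n generalizing x with
  | zero => exact h
  | succ n ih =>
    rw [sqn]
    apply ih
    rw [Nat.le_div_iff_mul_le SC_npos]
    exact Nat.mul_le_mul h h

lemma Uinv_le (p : ℕ) (hp : 0 < p) : (p : ℝ) ^ (-(1 / 2) : ℝ) ≤ (Uinv p : ℝ) / 1048576 := by
  have hp' : (0 : ℝ) < p := by exact_mod_cast hp
  have h := expPos_le (logLo p / 2) (Real.log p / 2) (by
    refine (vv_div_le _ _).trans ?_
    have := logLo_le p hp
    push_cast
    linarith)
  have he : SC ≤ expPos (logLo p / 2) := sqn_ge _ _ (Nat.le_add_right _ _)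
  unfold Uinv
  rw [if_neg (by simp; omega)]
  obtain ⟨e, hee⟩ : ∃ e, e = expPos (logLo p / 2) := ⟨_, rfl⟩
  rw [← hee] at h he ⊢
  have he0 : 0 < e := SC_npos.trans_le he
  have he0' : (0 : ℝ) < e := by exact_mod_cast he0
  have hSC := SC_pos
  have h3 : 1048576 * (SC : ℝ) ≤ ((1048576 * SC / e + 1 : ℕ) : ℝ) * e := by
    have := (Nat.lt_mul_div_succ (1048576 * SC) he0).le
    rw [mul_comm e] at this
    exact_mod_cast this
  rw [le_div_iff₀ (by norm_num), Real.rpow_def_of_pos hp', show Real.log p * (-(1 / 2) : ℝ) = -(Real.log p / 2) by ring,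
    Real.exp_neg]
  have h4 : (Real.exp (Real.log p / 2))⁻¹ ≤ (vv e)⁻¹ := inv_anti₀ (div_pos he0' hSC) h
  have h5 : (vv e)⁻¹ * 1048576 ≤ ((1048576 * SC / e + 1 : ℕ) : ℝ) := by
    unfold vv
    rw [inv_div, div_mul_eq_mul_div, div_le_iff₀ he0']
    linarith
  linarith

lemma Winv_le (r : Rec) (p : ℕ) (hp : 0 < p) (θ : ℝ) (ht : r.inf = true ∨ θ ≤ (r.t2 : ℝ) / 10000) :
    (Winv r p : ℝ) / 1048576 ≤ (p : ℝ) ^ (-θ) := by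
  have hp' : (0 : ℝ) < p := by exact_mod_cast hp
  have hp1 : (1 : ℝ) ≤ p := by exact_mod_cast hp
  unfold Winv
  by_cases hi : r.inf = true
  · simp only [hi, Bool.true_or, if_true]
    simp
    positivity
  · have hi' : r.inf = false := by simpa using hi
    have ht := ht.resolve_left hi
    rw [if_neg (by simp [hi']; omega)]
    have h1 := expNeg_le (r.t2 * logHi p / 10000 + 1) (θ * Real.log p) (by
      refine le_trans ?_ (le_vv_div' _ _ (by norm_num))
      rw [vv_mul]
      have := le_logHi p hp
      have := Real.log_nonneg hp1
      push_cast
      calc θ * Real.log p ≤ (r.t2 : ℝ) / 10000 * vv (logHi p) := by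
            apply mul_le_mul ht (by assumption) (by assumption) (by positivity)
        _ = _ := by ring)
    rw [Real.rpow_def_of_pos hp', show Real.log p * (-θ) = -(θ * Real.log p) by ring]
    refine le_trans ?_ h1
    have hSC := SC_pos
    rw [div_le_iff₀ (by norm_num), vv, div_mul_eq_mul_div]
    refine Nat.cast_div_le.trans (le_of_eq ?_)
    push_cast
    rfl

lemma AA_s0_bound (p : ℕ) (hp : p = 0 ∨ p.Prime) (y : ℝ) (hy : 0 < y) :
    |AA (s0 p) y| ≤ (1 + (Uinv p : ℝ) / 1048576) ^ 2 * Real.sqrt y + 1 := by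
  rcases hp with rfl | hp
  · have := AA_empty_bound y hy
    simp [s0, Uinv]
    linarith
  · have e : s0 p = insert p ∅ := by rw [s0, if_neg hp.ne_zero]; rfl
    have hp' : (0 : ℝ) < p := by exact_mod_cast hp.pos
    rw [e, AA_insert ∅ p hp (by simp) (by simp) y hy]
    have a1 := AA_empty_bound y hy
    have a2 := AA_empty_bound (y / p) (by positivity)
    have a3 := AA_empty_bound (y / p / p) (by positivity)
    have u := Uinv_le p hp.pos
    obtain ⟨w, hw⟩ : ∃ w, w = (p : ℝ) ^ (-(1 / 2) : ℝ) := ⟨_, rfl⟩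
    have hw0 : 0 ≤ w := by rw [hw]; positivity
    have hw2 : w = (Real.sqrt p)⁻¹ := by rw [hw, Real.rpow_neg hp'.le, Real.sqrt_eq_rpow]
    rw [← hw] at u
    rw [Real.sqrt_div' _ hp'.le, div_eq_mul_inv (Real.sqrt _), ← hw2] at a2
    rw [Real.sqrt_div' _ hp'.le, Real.sqrt_div' _ hp'.le, div_eq_mul_inv _ (Real.sqrt _), div_eq_mul_inv _ (Real.sqrt _), ← hw2] at a3
    have b : (1 + w) ^ 2 * Real.sqrt y ≤ (1 + (Uinv p : ℝ) / 1048576) ^ 2 * Real.sqrt y := by gcongr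
    rw [abs_le] at a1 a2 a3 ⊢
    constructor
    · linarith [a1.1, a2.2, a3.1]
    · linarith [a1.2, a2.1, a3.2]

lemma tail_ok (r : Rec) (hp : r.p0 = 0 ∨ r.p0.Prime) (hN : 1 ≤ r.N) (h : tail r = true) (h5 : 5000 ≤ r.t1)
    (θ : ℝ) (h1 : (r.t1 : ℝ) / 10000 ≤ θ) (y : ℝ) (hy : (r.N : ℝ) ≤ y) :
    |AA (s0 r.p0) y| ≤ (r.B : ℝ) / 10000 * y ^ θ + (r.M : ℝ) / 10000 * y ^ (1 / 2 : ℝ) := by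
  unfold tail at h
  rw [Nat.ble_eq] at h
  have h := (Nat.cast_le (α := ℝ)).2 h
  have hN' : (1 : ℝ) ≤ r.N := by exact_mod_cast hN
  have hy0 : 0 < y := by linarith
  have b := AA_s0_bound r.p0 hp y hy0
  have u := Uinv_le r.N hN
  have hSC := SC_pos
  have hs0 := Real.sqrt_nonneg y
  have c1 : 1 ≤ (Uinv r.N : ℝ) / 1048576 * Real.sqrt y := by
    have : (r.N : ℝ) ^ (-(1 / 2) : ℝ) * Real.sqrt y ≤ (Uinv r.N : ℝ) / 1048576 * Real.sqrt y := by gcongr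
    refine le_trans ?_ this
    have : Real.sqrt r.N ≤ Real.sqrt y := Real.sqrt_le_sqrt hy
    have hs : 0 < Real.sqrt r.N := Real.sqrt_pos.2 (by linarith)
    rw [Real.rpow_neg (by linarith), ← Real.sqrt_eq_rpow, inv_mul_eq_div, le_div_iff₀ hs]
    linarith
  have ex := expPos_le ((r.t1 - 5000) * logLo r.N / 10000) ((θ - 1 / 2) * Real.log y) (by
    refine (vv_div_le _ _).trans ?_
    rw [vv_mul]
    have l1 := logLo_le r.N hN
    have l2 : Real.log r.N ≤ Real.log y := Real.log_le_log (by linarith) hy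
    push_cast [h5]
    calc ((r.t1 : ℝ) - 5000) * vv (logLo r.N) / 10000 = (r.t1 / 10000 - 1 / 2) * vv (logLo r.N) := by ring
      _ ≤ (θ - 1 / 2) * Real.log y := by
        have : (5000 : ℝ) ≤ r.t1 := by exact_mod_cast h5
        apply mul_le_mul (by linarith) (by linarith) (vv_nonneg _) (by linarith))
  have sq : y ^ (1 / 2 : ℝ) = Real.sqrt y := (Real.sqrt_eq_rpow y).symm
  have pw : y ^ θ = Real.exp ((θ - 1 / 2) * Real.log y) * Real.sqrt y := by
    rw [← sq, Real.rpow_def_of_pos hy0, Real.rpow_def_of_pos hy0, ← Real.exp_add]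
    apply congrArg; ring
  rw [sq, pw]
  generalize expPos ((r.t1 - 5000) * logLo r.N / 10000) = e at *
  have k : (1 + (Uinv r.p0 : ℝ) / 1048576) ^ 2 + (Uinv r.N : ℝ) / 1048576 ≤ ((r.B : ℝ) * vv e + r.M) / 10000 := by
    push_cast at h
    rw [← sub_nonneg]
    have : ((r.B : ℝ) * vv e + r.M) / 10000 - ((1 + (Uinv r.p0 : ℝ) / 1048576) ^ 2 + (Uinv r.N : ℝ) / 1048576) =
       (1048576 * 1048576 * ((r.B : ℝ) * e + r.M * SC) - ((1048576 + (Uinv r.p0 : ℝ)) * (1048576 + (Uinv r.p0 : ℝ)) + 1048576 * (Uinv r.N : ℝ)) * 10000 * SC) / (1048576 * 1048576 * 10000 * SC) := by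
      unfold vv; field_simp
    rw [this]
    exact div_nonneg (by linarith) (by positivity)
  have k2 : ((r.B : ℝ) * vv e + r.M) / 10000 ≤ ((r.B : ℝ) * Real.exp ((θ - 1 / 2) * Real.log y) + r.M) / 10000 := by gcongr
  have k3 := mul_le_mul_of_nonneg_right (k.trans k2) hs0
  linarith

lemma point_ok (r : Rec) (hp : r.p0 = 0 ∨ r.p0.Prime) (h : chk r = true) 
    (θ : ℝ) (h1 : (r.t1 : ℝ) / 10000 ≤ θ) (ht : r.inf = true ∨ θ ≤ (r.t2 : ℝ) / 10000) (y : ℝ) (hy : 0 < y) :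
    |AA (s0 r.p0) y| ≤ (r.B : ℝ) / 10000 * y ^ θ + (r.M : ℝ) / 10000 * y ^ (1 / 2 : ℝ) := by
  unfold chk side at h
  simp only [Bool.and_eq_true, Nat.ble_eq] at h
  obtain ⟨⟨⟨⟨⟨⟨⟨⟨⟨⟨⟨⟨⟨⟨⟨⟨⟨⟨⟨s1, s2⟩, s3⟩, s4⟩, s5⟩, s6⟩, s7⟩, s8⟩, s9⟩, s10⟩, s11⟩, s12⟩, s13⟩, s14⟩, s15⟩, s16⟩, hh⟩, htl⟩, hc⟩, ha⟩ := h
  by_cases y1 : y < 1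
  · refine head_ok r hp _ hh s7 s8 s9 s10 θ ?_ y hy y1
    by_cases hi : r.inf = true
    · left; simp [hi]
    · right; simp [hi, ht.resolve_left hi]
  · by_cases y2 : y < r.N
    · exact cells_ok r hp s11 θ h1 400 4 le_rfl hc y (by push Not at y1; norm_num; exact y1) y2
    · exact tail_ok r hp s12 htl s13 θ h1 y (by push Not at y2; exact y2)
end S8

namespace S8
open Finset

lemma plist_mem : ∀ p < 401, p.Prime → p ∈ plist := by decide +kernel
lemma plist_nodup : plist.Nodup := by decide +kernel

noncomputable def HH (l θ : ℝ) (p : ℕ) : ℝ :=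
  2 * Real.log (1 + (p : ℝ) ^ (-(1 / 2) : ℝ)) - 2 * l * Real.log (1 + (p : ℝ) ^ (-θ)) - (1 - l) * Real.log (2 - 2 / (p : ℝ))

lemma log20 (a : ℝ) (ha : 0 ≤ a) : Real.log (1 + a / 1048576) = Real.log (1048576 + a) - 20 * Real.log 2 := by
  have : (20 : ℝ) * Real.log 2 = Real.log 1048576 := by
    rw [show (1048576 : ℝ) = 2 ^ 20 by norm_num, Real.log_pow]; norm_num
  rw [this, ← Real.log_div (by positivity) (by norm_num)]
  congr 1; field_simp

lemma hp_ok (r : Rec) (p : ℕ) (hp : p.Prime) (hl : r.lam ≤ 8475) (θ : ℝ) (ht : r.inf = true ∨ θ ≤ (r.t2 : ℝ) / 10000) :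
    HH ((r.lam : ℝ) / 10000) θ p ≤ vv (S8.hp r p) / 10000 := by
  have hp' : (2 : ℝ) ≤ p := by exact_mod_cast hp.two_le
  have u := Uinv_le p hp.pos
  have w := Winv_le r p hp.pos θ ht
  have a0 : (0 : ℝ) ≤ (p : ℝ) ^ (-(1 / 2) : ℝ) := by positivity
  have b0 : (0 : ℝ) ≤ (p : ℝ) ^ (-θ) := by positivity
  have U0 : (0 : ℝ) ≤ (Uinv p : ℝ) := Nat.cast_nonneg _
  have W0 : (0 : ℝ) ≤ (Winv r p : ℝ) := Nat.cast_nonneg _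
  have W1 : (0 : ℝ) < 1 + (Winv r p : ℝ) / 1048576 := by positivity
  have L0 : (0 : ℝ) ≤ 2 * r.lam := by positivity
  have A : Real.log (1 + (p : ℝ) ^ (-(1 / 2) : ℝ)) ≤ vv (logHi (1048576 + Uinv p) - 20 * l2lo) := by
    refine le_trans (Real.log_le_log (by positivity) (add_le_add_right u 1)) ?_
    rw [log20 _ (by positivity)]
    refine le_trans ?_ (le_vv_sub _ _)
    rw [vv_mul]
    have := le_logHi (1048576 + Uinv p) (by omega)
    have := l2lo_le
    push_cast at *
    linarith
  have W : vv (logLo (1048576 + Winv r p) - 20 * l2hi) ≤ Real.log (1 + (p : ℝ) ^ (-θ)) := by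
    apply vv_sub_le
    · apply Real.log_nonneg; linarith
    · refine le_trans ?_ (Real.log_le_log W1 (add_le_add_right w 1))
      rw [log20 _ W0]
      rw [vv_mul]
      have := logLo_le (1048576 + Winv r p) (by omega)
      have := le_l2hi
      push_cast at *
      linarith
  have Z : vv (logLo (2 * p - 2) - logHi p) ≤ Real.log (2 - 2 / (p : ℝ)) := by
    have h2 := hp.two_le
    apply vv_sub_le
    · apply Real.log_nonneg
      have : 2 / (p : ℝ) ≤ 1 := by rw [div_le_one (by linarith)]; exact hp'
      linarith
    · have := logLo_le (2 * p - 2) (by omega)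
      have := le_logHi p hp.pos
      have e : (2 : ℝ) - 2 / p = ((2 * p - 2 : ℕ) : ℝ) / p := by
        push_cast [show 2 ≤ 2 * p by omega]
        field_simp
      rw [e, Real.log_div (by norm_cast; omega) (by positivity)]
      linarith
  unfold S8.hp HH
  rw [le_div_iff₀ (by norm_num)]
  refine le_trans ?_ (le_vv_sub _ _)
  rw [vv_add, vv_mul, vv_mul, vv_mul]
  have hl' : (r.lam : ℝ) ≤ 10000 := by exact_mod_cast (by omega : r.lam ≤ 10000)
  push_cast [show r.lam ≤ 10000 by omega]
  generalize vv (logHi (1048576 + Uinv p) - 20 * l2lo) = X1 at *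
  generalize vv (logLo (1048576 + Winv r p) - 20 * l2hi) = X2 at *
  generalize vv (logLo (2 * p - 2) - logHi p) = X3 at *
  have q1 := mul_le_mul_of_nonneg_left W L0
  have q2 := mul_le_mul_of_nonneg_left Z (show (0 : ℝ) ≤ 10000 - r.lam by linarith)
  linarith

lemma HH_large (l θ : ℝ) (h0 : 0 ≤ l) (hl : l ≤ 0.8475) (p : ℕ) (hp : 401 ≤ p) : HH l θ p ≤ 0 := by
  have hp' : (401 : ℝ) ≤ p := by exact_mod_cast hp
  unfold HH
  have b0 : (0 : ℝ) ≤ (p : ℝ) ^ (-θ) := by positivity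
  have b1 : 0 ≤ Real.log (1 + (p : ℝ) ^ (-θ)) := Real.log_nonneg (by linarith)
  have a0 : (0 : ℝ) ≤ (p : ℝ) ^ (-(1 / 2) : ℝ) := by positivity
  have a1 : (p : ℝ) ^ (-(1 / 2) : ℝ) ≤ 1 / 20 := by
    rw [Real.rpow_neg (by linarith), ← Real.sqrt_eq_rpow, one_div]
    apply inv_anti₀ (by norm_num)
    apply Real.le_sqrt_of_sq_le; linarith
  have a2 : Real.log (1 + (p : ℝ) ^ (-(1 / 2) : ℝ)) ≤ 1 / 20 := by
    have := Real.log_le_sub_one_of_pos (show 0 < 1 + (p : ℝ) ^ (-(1 / 2) : ℝ) by linarith)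
    linarith
  have c1 : (0.68 : ℝ) ≤ Real.log (2 - 2 / (p : ℝ)) := by
    have e : (2 : ℝ) - 2 / p = 2 * (1 - 1 / p) := by ring
    have e2 : 1 / (p : ℝ) ≤ 1 / 400 := by
      apply one_div_le_one_div_of_le <;> linarith
    have e3 := Real.log_two_gt_d9
    rw [e, Real.log_mul (by norm_num) (by linarith)]
    have e4 := Real.one_sub_inv_le_log_of_pos (show 0 < 1 - 1 / (p : ℝ) by linarith)
    have e5 : (1 - 1 / (p : ℝ))⁻¹ ≤ (399 / 400 : ℝ)⁻¹ := inv_anti₀ (by norm_num) (by linarith)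
    norm_num at e5 e4 ⊢
    linarith
  have c2 : (1 - l) * 0.68 ≤ (1 - l) * Real.log (2 - 2 / (p : ℝ)) := mul_le_mul_of_nonneg_left c1 (by linarith)
  have c3 : 0 ≤ 2 * l * Real.log (1 + (p : ℝ) ^ (-θ)) := by positivity
  linarith

lemma vv_zero : vv 0 = 0 := by unfold vv; rw [Nat.cast_zero, zero_div]

lemma hsum_eq (r : Rec) (l : List ℕ) : vv (hsum r l) = (l.map (fun p => if r.minp ≤ p then vv (hp r p) else 0)).sum := by
  induction l with
  | nil => rw [hsum, vv_zero, List.map_nil, List.sum_nil]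
  | cons p l ih =>
    rw [hsum, vv_add, ih, List.map_cons, List.sum_cons]
    congr 1
    simp only [Nat.ble_eq]
    split_ifs
    · rfl
    · exact vv_zero

lemma sum_HH (r : Rec) (hl : r.lam ≤ 8475) (θ : ℝ) (ht : r.inf = true ∨ θ ≤ (r.t2 : ℝ) / 10000)
    (s : Finset ℕ) (hs : ∀ p ∈ s, p.Prime) (hm : ∀ p ∈ s, r.minp ≤ p) :
    ∑ p ∈ s, HH ((r.lam : ℝ) / 10000) θ p ≤ vv (hsum r plist) / 10000 := by
  have hl' : (r.lam : ℝ) ≤ 8475 := by exact_mod_cast hl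
  rw [hsum_eq, ← List.sum_toFinset _ plist_nodup, sum_div]
  have h1 : ∑ p ∈ s, HH ((r.lam : ℝ) / 10000) θ p ≤ ∑ p ∈ s.filter (· < 401), vv (hp r p) / 10000 := by
    rw [sum_filter]
    apply sum_le_sum
    intro p hps
    split_ifs with h
    · exact hp_ok r p (hs p hps) hl θ ht
    · exact HH_large _ _ (by positivity) (by linarith) p (by omega)
  refine h1.trans ?_
  have h2 : ∑ p ∈ s.filter (· < 401), vv (hp r p) / 10000 = ∑ p ∈ s.filter (· < 401), (if r.minp ≤ p then vv (hp r p) else 0) / 10000 := by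
    apply sum_congr rfl
    intro p hp
    rw [if_pos (hm p (mem_filter.1 hp).1)]
  rw [h2]
  apply sum_le_sum_of_subset_of_nonneg
  · intro p hp
    rw [mem_filter] at hp
    exact List.mem_toFinset.2 (plist_mem p hp.2 (hs p hp.1))
  · intro p _ _
    have := vv_nonneg (hp r p)
    split_ifs
    · exact div_nonneg this (by norm_num)
    · simp

/-- Weighted AM-GM in log form. -/
lemma amgm_log (a b m l : ℝ) (ha : 0 < a) (hb : 0 < b) (hm : 0 < m) (h0 : 0 < l) (h1 : l < 1)
    (h : Real.log m ≤ l * (Real.log a - Real.log l) + (1 - l) * (Real.log b - Real.log (1 - l))) : m ≤ a + b := by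
  have h1' : 0 < 1 - l := by linarith
  have g := Real.geom_mean_le_arith_mean2_weighted h0.le h1'.le (div_pos ha h0).le (div_pos hb h1').le (by ring)
  have e : l * (a / l) + (1 - l) * (b / (1 - l)) = a + b := by field_simp
  rw [e] at g
  refine le_trans ?_ g
  rw [← Real.log_div (by positivity) (by positivity), ← Real.log_div (by positivity) (by positivity)] at h
  rw [← Real.exp_log hm, Real.rpow_def_of_pos (div_pos ha h0), Real.rpow_def_of_pos (div_pos hb h1'), ← Real.exp_add]
  apply Real.exp_le_exp.2
  linarith

lemma amgm_ok (r : Rec) (h : amgm r = true) (s1 : 50000000 ≤ r.lam * r.t1) (s2 : r.lam ≤ 8475) (s3 : 1 ≤ r.lam)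
    (s4 : 1 ≤ r.M) (s5 : 1 ≤ r.W) (s6 : 1 ≤ r.S)
    (θ : ℝ) (h1 : (r.t1 : ℝ) / 10000 ≤ θ) (ht : r.inf = true ∨ θ ≤ (r.t2 : ℝ) / 10000)
    (s : Finset ℕ) (hs : ∀ p ∈ s, p.Prime) (hm : ∀ p ∈ s, r.minp ≤ p) (x : ℝ) (hx : 3 ≤ x) :
    (r.M : ℝ) / 10000 * (∏ p ∈ s, (1 + (p : ℝ) ^ (-(1 / 2) : ℝ)) ^ 2) * x ^ (1 / 2 : ℝ) ≤
    (r.W : ℝ) / 10000 * (∏ p ∈ s, (1 + (p : ℝ) ^ (-θ)) ^ 2) * x ^ θ + (r.S : ℝ) / 10000 * ∏ p ∈ s, (2 - 2 / (p : ℝ)) := by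
  have q2 : (r.lam : ℝ) ≤ 8475 := by exact_mod_cast s2
  have q3 : (1 : ℝ) ≤ r.lam := by exact_mod_cast s3
  have q4 : (1 : ℝ) ≤ r.M := by exact_mod_cast s4
  have q5 : (1 : ℝ) ≤ r.W := by exact_mod_cast s5
  have q6 : (1 : ℝ) ≤ r.S := by exact_mod_cast s6
  have hx0 : 0 < x := by linarith
  have p1 : ∀ p ∈ s, 0 < (1 + (p : ℝ) ^ (-(1 / 2) : ℝ)) := fun p _ => by positivity
  have p2 : ∀ p ∈ s, 0 < (1 + (p : ℝ) ^ (-θ)) := fun p _ => by positivity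
  have p3 : ∀ p ∈ s, 0 < (2 - 2 / (p : ℝ)) := fun p hp => by
    have : (2 : ℝ) ≤ p := by exact_mod_cast (hs p hp).two_le
    have : 2 / (p : ℝ) ≤ 1 := by rw [div_le_one (by linarith)]; exact this
    linarith
  have P1 : 0 < ∏ p ∈ s, (1 + (p : ℝ) ^ (-(1 / 2) : ℝ)) ^ 2 := prod_pos fun p hp => pow_pos (p1 p hp) 2
  have P2 : 0 < ∏ p ∈ s, (1 + (p : ℝ) ^ (-θ)) ^ 2 := prod_pos fun p hp => pow_pos (p2 p hp) 2
  have P3 : 0 < ∏ p ∈ s, (2 - 2 / (p : ℝ)) := prod_pos p3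
  have M0 : (0 : ℝ) < (r.M : ℝ) / 10000 := by linarith
  have W0 : (0 : ℝ) < (r.W : ℝ) / 10000 := by linarith
  have S0 : (0 : ℝ) < (r.S : ℝ) / 10000 := by linarith
  have X1 : 0 < x ^ (1 / 2 : ℝ) := by positivity
  have X2 : 0 < x ^ θ := by positivity
  have hsum := sum_HH r s2 θ ht s hs hm
  have L1 : Real.log (∏ p ∈ s, (1 + (p : ℝ) ^ (-(1 / 2) : ℝ)) ^ 2) = ∑ p ∈ s, 2 * Real.log (1 + (p : ℝ) ^ (-(1 / 2) : ℝ)) := by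
    rw [Real.log_prod (fun p hp => (pow_pos (p1 p hp) 2).ne')]
    apply sum_congr rfl; intro p hp; rw [Real.log_pow]; norm_num
  have L2 : Real.log (∏ p ∈ s, (1 + (p : ℝ) ^ (-θ)) ^ 2) = ∑ p ∈ s, 2 * Real.log (1 + (p : ℝ) ^ (-θ)) := by
    rw [Real.log_prod (fun p hp => (pow_pos (p2 p hp) 2).ne')]
    apply sum_congr rfl; intro p hp; rw [Real.log_pow]; norm_num
  have L3 : Real.log (∏ p ∈ s, (2 - 2 / (p : ℝ))) = ∑ p ∈ s, Real.log (2 - 2 / (p : ℝ)) :=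
    Real.log_prod (fun p hp => (p3 p hp).ne')
  have L4 : ∑ p ∈ s, HH ((r.lam : ℝ) / 10000) θ p = Real.log (∏ p ∈ s, (1 + (p : ℝ) ^ (-(1 / 2) : ℝ)) ^ 2) -
      (r.lam : ℝ) / 10000 * Real.log (∏ p ∈ s, (1 + (p : ℝ) ^ (-θ)) ^ 2) - (1 - (r.lam : ℝ) / 10000) * Real.log (∏ p ∈ s, (2 - 2 / (p : ℝ))) := by
    rw [L1, L2, L3, mul_sum, mul_sum, ← sum_sub_distrib, ← sum_sub_distrib]
    apply sum_congr rfl; intro p _; unfold HH; ring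
  rw [L4] at hsum
  apply amgm_log _ _ _ ((r.lam : ℝ) / 10000) (by positivity) (by positivity) (by positivity) (by linarith) (by linarith)
  rw [Real.log_mul (by positivity) X1.ne', Real.log_mul M0.ne' P1.ne', Real.log_mul (by positivity) X2.ne',
    Real.log_mul W0.ne' P2.ne', Real.log_mul S0.ne' P3.ne', Real.log_rpow hx0, Real.log_rpow hx0]
  generalize Real.log (∏ p ∈ s, (1 + (p : ℝ) ^ (-(1 / 2) : ℝ)) ^ 2) = Y1 at *
  generalize Real.log (∏ p ∈ s, (1 + (p : ℝ) ^ (-θ)) ^ 2) = Y2 at *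
  generalize Real.log (∏ p ∈ s, (2 - 2 / (p : ℝ))) = Y3 at *
  have e1 : (1 : ℝ) - (r.lam : ℝ) / 10000 = ((10000 - r.lam : ℕ) : ℝ) / 10000 := by
    push_cast [show r.lam ≤ 10000 by omega]; ring
  have l1 : (1 : ℝ) ≤ ((10000 - r.lam : ℕ) : ℝ) := by exact_mod_cast (by omega : 1 ≤ 10000 - r.lam)
  have E := e1
  rw [Real.log_div (by positivity) (by norm_num), Real.log_div (by positivity) (by norm_num),
    Real.log_div (by positivity) (by norm_num), Real.log_div (by positivity) (by norm_num), e1, Real.log_div (by positivity) (by norm_num)]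
  unfold amgm at h
  rw [Nat.ble_eq] at h
  have h := vv_mono h
  simp only [vv_add, vv_mul] at h
  have k1 := mul_le_mul_of_nonneg_left (le_logHi r.lam s3) (Nat.cast_nonneg r.lam)
  have k2 := mul_le_mul_of_nonneg_left (le_logHi (10000 - r.lam) (by omega)) (Nat.cast_nonneg (10000 - r.lam))
  have k3 := le_logHi r.M s4
  have k4 := mul_le_mul_of_nonneg_left (logLo_le r.W s5) (Nat.cast_nonneg r.lam)
  have k5 := mul_le_mul_of_nonneg_left (logLo_le r.S s6) (Nat.cast_nonneg (10000 - r.lam))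
  have k6 := logLo_le 10000 (by norm_num)
  have k7 := logLo_le 3 (by norm_num)
  have k8 : Real.log 3 ≤ Real.log x := Real.log_le_log (by norm_num) hx
  have k9 : ((r.lam * r.t1 / 10000 - 5000 : ℕ) : ℝ) ≤ r.lam * θ - 5000 := by
    have : 5000 ≤ r.lam * r.t1 / 10000 := by omega
    rw [Nat.cast_sub this]
    have a := Nat.cast_div_le (α := ℝ) (m := r.lam * r.t1) (n := 10000)
    push_cast at a
    have b := mul_le_mul_of_nonneg_left h1 (Nat.cast_nonneg r.lam)
    push_cast
    linarith
  push_cast at k6 k7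
  have k10 : ((r.lam * r.t1 / 10000 - 5000 : ℕ) : ℝ) * vv (logLo 3) ≤ (r.lam * θ - 5000) * Real.log x :=
    mul_le_mul k9 (k7.trans k8) (vv_nonneg _) ((Nat.cast_nonneg _).trans k9)
  generalize vv (logLo 10000) = z1 at *
  generalize vv (logLo 3) = z2 at *
  generalize ((r.lam * r.t1 / 10000 - 5000 : ℕ) : ℝ) = z3 at *
  generalize ((10000 - r.lam : ℕ) : ℝ) = z4 at *
  have E' : z4 = 10000 - r.lam := by linarith
  subst E'
  rw [e1] at hsum
  push_cast at h
  linarith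
end S8

namespace S8
open Finset


lemma s0_prod (p0 : ℕ) (f : ℕ → ℝ) : ∏ p ∈ s0 p0, f p = if p0 = 0 then 1 else f p0 := by
  unfold s0; split_ifs <;> simp

def Bd (C θ x : ℝ) (s : Finset ℕ) : Prop := |AA s x| ≤ C * (∏ p ∈ s, (1 + (p : ℝ) ^ (-θ)) ^ 2) * x ^ θ +
      (1 - Real.eulerMascheroniConstant) * ∏ p ∈ s, (2 - 2 / (p : ℝ))

lemma side_W (r : Rec) (hp : r.p0 = 0 ∨ r.p0.Prime) (θ C : ℝ) (ht : r.inf = true ∨ θ ≤ (r.t2 : ℝ) / 10000) (hC : 0.84556 ≤ C)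
    (h : (r.B + r.W) * 10 * 1048576 * 1048576 ≤ 84556 * ((1048576 + Winv r r.p0) * (1048576 + Winv r r.p0))) :
    (r.B : ℝ) / 10000 + (r.W : ℝ) / 10000 ≤ C * ∏ p ∈ s0 r.p0, (1 + (p : ℝ) ^ (-θ)) ^ 2 := by
  have h' := (Nat.cast_le (α := ℝ)).2 h
  push_cast at h'
  have w0 : (0 : ℝ) ≤ Winv r r.p0 := Nat.cast_nonneg _
  have k : (r.B : ℝ) / 10000 + (r.W : ℝ) / 10000 ≤ 0.84556 * (1 + (Winv r r.p0 : ℝ) / 1048576) ^ 2 := by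
    have : (0.84556 : ℝ) * (1 + (Winv r r.p0 : ℝ) / 1048576) ^ 2 = 84556 * ((1048576 + (Winv r r.p0 : ℝ)) * (1048576 + (Winv r r.p0 : ℝ))) / (100000 * 1048576 * 1048576) := by
      field_simp
      ring
    rw [this, le_div_iff₀ (by norm_num)]
    linarith
  refine k.trans ?_
  rw [s0_prod]
  rcases hp with hp | hp
  · have : Winv r r.p0 = 0 := by rw [hp]; unfold Winv; simp
    rw [this, if_pos hp]
    norm_num; linarith
  · rw [if_neg hp.ne_zero]
    have := Winv_le r r.p0 hp.pos θ ht
    gcongr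

lemma side_S (r : Rec) (hp : r.p0 = 0 ∨ r.p0.Prime)
    (h : (if Nat.beq r.p0 0 then Nat.ble (r.S * 10) 42278 else Nat.ble (r.S * 10 * r.p0) (42278 * (2 * r.p0 - 2))) = true) :
    (r.S : ℝ) / 10000 ≤ (1 - Real.eulerMascheroniConstant) * ∏ p ∈ s0 r.p0, (2 - 2 / (p : ℝ)) := by
  have g := gamma_hi
  rw [s0_prod]
  rcases hp with hp | hp
  · rw [if_pos hp]
    simp only [hp, Nat.beq_eq, if_true, Nat.ble_eq] at h
    have h' := (Nat.cast_le (α := ℝ)).2 h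
    push_cast at h'
    linarith
  · have h2 := hp.two_le
    have h0 := hp.ne_zero
    have h2' : (2 : ℝ) ≤ r.p0 := by exact_mod_cast h2
    rw [if_neg h0]
    simp only [h0, Nat.beq_eq, if_false, Nat.ble_eq] at h
    have h' := (Nat.cast_le (α := ℝ)).2 h
    push_cast [show 2 ≤ 2 * r.p0 by omega] at h'
    have a : (0 : ℝ) ≤ 2 - 2 / (r.p0 : ℝ) := by
      have : 2 / (r.p0 : ℝ) ≤ 1 := by rw [div_le_one (by linarith)]; exact h2'
      linarith
    have b : 0.42278 * (2 - 2 / (r.p0 : ℝ)) ≤ (1 - Real.eulerMascheroniConstant) * (2 - 2 / (r.p0 : ℝ)) := by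
      apply mul_le_mul_of_nonneg_right _ a; linarith
    refine le_trans ?_ b
    have e : (0.42278 : ℝ) * (2 - 2 / (r.p0 : ℝ)) = (42278 * (2 * r.p0 - 2)) / (100000 * r.p0) := by
      field_simp; ring
    rw [e, le_div_iff₀ (by linarith)]
    linarith

lemma rec_ok (r : Rec) (hp : r.p0 = 0 ∨ r.p0.Prime) (h : chk r = true) 
    (θ : ℝ) (h1 : (r.t1 : ℝ) / 10000 ≤ θ) (ht : r.inf = true ∨ θ ≤ (r.t2 : ℝ) / 10000) (C : ℝ) (hC : 0.84556 ≤ C)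
    (s : Finset ℕ) (hs : ∀ p ∈ s, p.Prime) (hm : ∀ p ∈ s, r.minp ≤ p) (hd : Disjoint s (s0 r.p0)) (x : ℝ) (hx : 3 ≤ x) :
    Bd C θ x (s ∪ s0 r.p0) := by
  have P := AA_bound (s0 r.p0) (s0_prime r.p0 hp) _ _ θ (point_ok r hp h θ h1 ht) s hs hd x (by linarith)
  unfold chk side at h
  simp only [Bool.and_eq_true, Nat.ble_eq] at h
  obtain ⟨⟨⟨⟨⟨⟨⟨⟨⟨⟨⟨⟨⟨⟨⟨⟨⟨⟨⟨s1, s2⟩, s3⟩, s4⟩, s5⟩, s6⟩, s7⟩, s8⟩, s9⟩, s10⟩, s11⟩, s12⟩, s13⟩, s14⟩, s15⟩, s16⟩, hh⟩, htl⟩, hc⟩, ha⟩ := h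
  have A := amgm_ok r ha s1 s2 s3 s4 s5 s6 θ h1 ht s hs hm x hx
  have w := side_W r hp θ C ht hC s14
  have v := side_S r hp s15
  clear s1 s2 s3 s4 s5 s6 s7 s8 s9 s10 s11 s12 s13 s14 s15 s16 hh htl hc ha
  unfold Bd
  rw [prod_union hd, prod_union hd]
  have G0 : 0 ≤ (∏ p ∈ s, (1 + (p : ℝ) ^ (-θ)) ^ 2) * x ^ θ := by
    apply mul_nonneg
    · exact prod_nonneg fun p _ => sq_nonneg _
    · exact Real.rpow_nonneg (by linarith) _
  have S0 : 0 ≤ ∏ p ∈ s, (2 - 2 / (p : ℝ)) := prod_nonneg fun p hp => by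
    have : (2 : ℝ) ≤ p := by exact_mod_cast (hs p hp).two_le
    have : 2 / (p : ℝ) ≤ 1 := by rw [div_le_one (by linarith)]; exact this
    linarith
  have w2 := mul_le_mul_of_nonneg_right w G0
  have v2 := mul_le_mul_of_nonneg_right v S0
  linarith

lemma easy_log : Real.log 2.885 ≤ 1.0614 := by
  have e := Real.exp_one_gt_d9
  have h := Real.log_le_sub_one_of_pos (show (0 : ℝ) < 2.885 / Real.exp 1 by positivity)
  rw [Real.log_div (by norm_num) (Real.exp_pos 1).ne', Real.log_exp] at h
  have : 2.885 / Real.exp 1 ≤ 1.0614 := by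
    rw [div_le_iff₀ (Real.exp_pos 1)]; linarith
  linarith

lemma easy (C θ : ℝ) (hC : 0.84556 ≤ C) (hθ : θ ≤ 0.59) (y : ℝ) (hy : 0 < y) (hy1 : y < 1) : |AA ∅ y| ≤ C * y ^ θ := by
  obtain ⟨u, hu⟩ : ∃ u, u = - Real.log y := ⟨_, rfl⟩
  have hu0 : 0 ≤ u := by rw [hu]; linarith [Real.log_nonpos hy.le hy1.le]
  have g1 := gamma_lo
  have g2 := gamma_hi
  rw [AA_empty_lt y hy1, ← hu, rpow_u y u hy hu θ, abs_mul, abs_of_pos hy]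
  have e1 := exp_lin 2.885 (0.41 * u) (by norm_num)
  have e2 : Real.exp (0.41 * u) ≤ Real.exp ((1 - θ) * u) := by
    apply Real.exp_le_exp.2
    apply mul_le_mul_of_nonneg_right _ hu0
    linarith
  have e3 : 1 ≤ Real.exp (0.41 * u) := Real.one_le_exp (by positivity)
  have l := easy_log
  have e4 : 0.84556 * Real.exp (0.41 * u) ≤ C * Real.exp ((1 - θ) * u) :=
    mul_le_mul hC e2 (Real.exp_pos _).le (by linarith)
  have : |u - (2 * Real.eulerMascheroniConstant - 1)| ≤ C * Real.exp ((1 - θ) * u) := by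
    rw [abs_le]
    constructor <;> linarith
  calc y * |u - (2 * Real.eulerMascheroniConstant - 1)| ≤ y * (C * Real.exp ((1 - θ) * u)) := by gcongr
    _ = _ := by ring

def good (p0 minp : ℕ) : Prop := ∀ θ C : ℝ, 0.59 ≤ θ → 0.84556 ≤ C → ∀ s : Finset ℕ, (∀ p ∈ s, p.Prime) →
  (∀ p ∈ s, minp ≤ p) → Disjoint s (s0 p0) → ∀ x : ℝ, 3 ≤ x → Bd C θ x (s ∪ s0 p0)

lemma good_use (p0 minp : ℕ) (h : good p0 minp) (hp0 : p0.Prime) (C θ : ℝ) (hθ : 0.59 ≤ θ) (hC : 0.84556 ≤ C)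
    (s : Finset ℕ) (hs : ∀ p ∈ s, p.Prime) (hmem : p0 ∈ s) (hm : ∀ p ∈ s, p ≠ p0 → minp ≤ p) (x : ℝ) (hx : 3 ≤ x) : Bd C θ x s := by
  have e0 : s0 p0 = {p0} := by unfold s0; rw [if_neg hp0.ne_zero]
  have e : s.erase p0 ∪ s0 p0 = s := by
    rw [e0]
    ext p
    simp only [mem_union, mem_erase, mem_singleton]
    constructor
    · rintro (⟨_, h⟩ | rfl) <;> assumption
    · intro h
      by_cases hp : p = p0
      · right; exact hp
      · left; exact ⟨hp, h⟩
  have := h θ C hθ hC (s.erase p0) (fun p hp => hs p (mem_of_mem_erase hp))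
    (fun p hp => hm p (mem_of_mem_erase hp) (ne_of_mem_erase hp)) (by rw [e0]; simp) x hx
  rwa [e] at this

lemma prime_ge3 (p : ℕ) (hp : p.Prime) (h2 : p ≠ 2) : 3 ≤ p := by
  have := hp.two_le; omega
lemma prime_ge5 (p : ℕ) (hp : p.Prime) (h2 : p ≠ 2) (h3 : p ≠ 3) : 5 ≤ p := by
  have := prime_ge3 p hp h2
  by_contra h
  interval_cases p <;> first | omega | (revert hp; norm_num)
lemma prime_ge7 (p : ℕ) (hp : p.Prime) (h2 : p ≠ 2) (h3 : p ≠ 3) (h5 : p ≠ 5) : 7 ≤ p := by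
  have := prime_ge5 p hp h2 h3
  by_contra h
  interval_cases p <;> first | omega | (revert hp; norm_num)
lemma prime_ge11 (p : ℕ) (hp : p.Prime) (h2 : p ≠ 2) (h3 : p ≠ 3) (h5 : p ≠ 5) (h7 : p ≠ 7) : 11 ≤ p := by
  have := prime_ge7 p hp h2 h3 h5
  by_contra h
  interval_cases p <;> first | omega | (revert hp; norm_num)
lemma prime_ge13 (p : ℕ) (hp : p.Prime) (h2 : p ≠ 2) (h3 : p ≠ 3) (h5 : p ≠ 5) (h7 : p ≠ 7) (h11 : p ≠ 11) : 13 ≤ p := by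
  have := prime_ge11 p hp h2 h3 h5 h7
  by_contra h
  interval_cases p <;> first | omega | (revert hp; norm_num)
lemma prime_ge17 (p : ℕ) (hp : p.Prime) (h2 : p ≠ 2) (h3 : p ≠ 3) (h5 : p ≠ 5) (h7 : p ≠ 7) (h11 : p ≠ 11) (h13 : p ≠ 13) : 17 ≤ p := by
  have := prime_ge13 p hp h2 h3 h5 h7 h11
  by_contra h
  interval_cases p <;> first | omega | (revert hp; norm_num)

end S8

namespace S8
open Finset


def rc0 : Rec := ⟨2, 3, 5900, 9590, false, 17646, 20, 1746, 4227, 8475, 323, 24650, 727052, 9950, 10001⟩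
lemma rk0 : chk rc0 = true := by decide +kernel
def rc1 : Rec := ⟨2, 3, 9590, 24530, false, 5321, 856, 6505, 4227, 5220, 43, 50, 59463, 3800, 14566⟩
lemma rk1 : chk rc1 = true := by decide +kernel
def rc2 : Rec := ⟨2, 3, 24530, 39470, false, 6999, 890, 2588, 4227, 3240, 3, 1, 56816, 1510, 13958⟩
lemma rk2 : chk rc2 = true := by decide +kernel
def rc3 : Rec := ⟨2, 3, 39470, 0, true, 2283, 3875, 6172, 4227, 4870, 3, 10000, 19532, 10000, 10001⟩
lemma rk3 : chk rc3 = true := by decide +kernel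
def rc4 : Rec := ⟨3, 5, 5900, 9010, false, 15117, 20, 791, 5637, 8475, 322, 30350, 10001, 9950, 10001⟩
lemma rk4 : chk rc4 = true := by decide +kernel
def rc5 : Rec := ⟨3, 5, 9010, 19900, false, 5544, 1718, 4918, 5637, 5550, 42, 500, 54984, 9050, 10001⟩
lemma rk5 : chk rc5 = true := by decide +kernel
def rc6 : Rec := ⟨3, 5, 19900, 34850, false, 4679, 1757, 4148, 5637, 3110, 4, 2, 50694, 4700, 11692⟩
lemma rk6 : chk rc6 = true := by decide +kernel
def rc7 : Rec := ⟨3, 5, 34850, 0, true, 507, 5579, 7948, 5637, 4730, 4, 10000, 22009, 10000, 10001⟩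
lemma rk7 : chk rc7 = true := by decide +kernel
def rc8 : Rec := ⟨5, 7, 5900, 8420, false, 12845, 20, 534, 6764, 8475, 306, 31550, 19748, 9950, 10001⟩
lemma rk8 : chk rc8 = true := by decide +kernel
def rc9 : Rec := ⟨5, 7, 8420, 15100, false, 4705, 2741, 5304, 6764, 5940, 64, 1920, 50208, 9950, 10001⟩
lemma rk9 : chk rc9 = true := by decide +kernel
def rc10 : Rec := ⟨5, 7, 15100, 0, true, 1353, 6149, 7102, 6764, 3320, 13, 10000, 25618, 10000, 10001⟩
lemma rk10 : chk rc10 = true := by decide +kernel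
def rc11 : Rec := ⟨7, 11, 5900, 8070, false, 11970, 20, 368, 7247, 8475, 242, 30650, 276590, 9950, 10001⟩
lemma rk11 : chk rc11 = true := by decide +kernel
def rc12 : Rec := ⟨7, 11, 8070, 13870, false, 4912, 3279, 4719, 7247, 6200, 58, 3200, 48551, 9950, 10001⟩
lemma rk12 : chk rc12 = true := by decide +kernel
def rc13 : Rec := ⟨7, 11, 13870, 0, true, 1945, 5910, 6510, 7247, 3610, 11, 10000, 28332, 10000, 10001⟩
lemma rk13 : chk rc13 = true := by decide +kernel
def rc14 : Rec := ⟨11, 13, 5900, 7660, false, 11139, 24, 225, 7686, 8475, 170, 31250, 105853, 9950, 10001⟩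
lemma rk14 : chk rc14 = true := by decide +kernel
def rc15 : Rec := ⟨11, 13, 7660, 12110, false, 4516, 3839, 4891, 7686, 6530, 76, 5300, 45715, 9950, 10001⟩
lemma rk15 : chk rc15 = true := by decide +kernel
def rc16 : Rec := ⟨11, 13, 12110, 0, true, 2537, 5257, 5918, 7686, 4130, 12, 10000, 32895, 10000, 10001⟩
lemma rk16 : chk rc16 = true := by decide +kernel
def rc17 : Rec := ⟨13, 17, 5900, 7540, false, 10855, 69, 222, 7805, 8475, 152, 30650, 100703, 9950, 10001⟩
lemma rk17 : chk rc17 = true := by decide +kernel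
def rc18 : Rec := ⟨13, 17, 7540, 12930, false, 3995, 4271, 5085, 7805, 6635, 105, 4250, 42339, 9950, 10001⟩
lemma rk18 : chk rc18 = true := by decide +kernel
def rc19 : Rec := ⟨13, 17, 12930, 0, true, 2537, 4968, 5918, 7805, 4170, 10, 10000, 34811, 10000, 10001⟩
lemma rk19 : chk rc19 = true := by decide +kernel
def rc20 : Rec := ⟨0, 17, 5900, 6130, false, 7187, 1587, 1268, 4227, 8475, 40, 26450, 35041, 9950, 10001⟩
lemma rk20 : chk rc20 = true := by decide +kernel
def rc21 : Rec := ⟨0, 17, 6130, 6490, false, 6342, 2376, 2113, 4227, 8160, 33, 25100, 37220, 9950, 10001⟩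
lemma rk21 : chk rc21 = true := by decide +kernel
def rc22 : Rec := ⟨0, 17, 6490, 7010, false, 4989, 3719, 3466, 4227, 7710, 28, 21200, 36800, 9950, 10001⟩
lemma rk22 : chk rc22 = true := by decide +kernel
def rc23 : Rec := ⟨0, 17, 7010, 7950, false, 3721, 4959, 4734, 4227, 7140, 25, 16700, 35222, 9950, 10001⟩
lemma rk23 : chk rc23 = true := by decide +kernel
def rc24 : Rec := ⟨0, 17, 7950, 10180, false, 2621, 6020, 5834, 4227, 6290, 20, 8900, 33376, 9950, 10001⟩
lemma rk24 : chk rc24 = true := by decide +kernel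
def rc25 : Rec := ⟨0, 17, 10180, 0, true, 1691, 6821, 6764, 4227, 4920, 12, 10000, 29335, 10000, 10001⟩
lemma rk25 : chk rc25 = true := by decide +kernel

lemma good2 : good 2 3 := by
  intro θ C hθ hC s hs hm hd x hx
  rcases le_total θ (9590 / 10000 : ℝ) with h0 | h0
  · exact rec_ok rc0 (Or.inr (by show Nat.Prime 2; norm_num)) rk0 θ (by show ((5900 : ℕ) : ℝ) / 10000 ≤ θ; norm_num at *; linarith) (Or.inr (by show θ ≤ ((9590 : ℕ) : ℝ) / 10000; norm_num at *; linarith)) C hC s hs hm hd x hx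
  rcases le_total θ (24530 / 10000 : ℝ) with h1 | h1
  · exact rec_ok rc1 (Or.inr (by show Nat.Prime 2; norm_num)) rk1 θ (by show ((9590 : ℕ) : ℝ) / 10000 ≤ θ; norm_num at *; linarith) (Or.inr (by show θ ≤ ((24530 : ℕ) : ℝ) / 10000; norm_num at *; linarith)) C hC s hs hm hd x hx
  rcases le_total θ (39470 / 10000 : ℝ) with h2 | h2
  · exact rec_ok rc2 (Or.inr (by show Nat.Prime 2; norm_num)) rk2 θ (by show ((24530 : ℕ) : ℝ) / 10000 ≤ θ; norm_num at *; linarith) (Or.inr (by show θ ≤ ((39470 : ℕ) : ℝ) / 10000; norm_num at *; linarith)) C hC s hs hm hd x hx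
  exact rec_ok rc3 (Or.inr (by show Nat.Prime 2; norm_num)) rk3 θ (by show ((39470 : ℕ) : ℝ) / 10000 ≤ θ; norm_num at *; linarith) (Or.inl rfl) C hC s hs hm hd x hx

lemma good3 : good 3 5 := by
  intro θ C hθ hC s hs hm hd x hx
  rcases le_total θ (9010 / 10000 : ℝ) with h4 | h4
  · exact rec_ok rc4 (Or.inr (by show Nat.Prime 3; norm_num)) rk4 θ (by show ((5900 : ℕ) : ℝ) / 10000 ≤ θ; norm_num at *; linarith) (Or.inr (by show θ ≤ ((9010 : ℕ) : ℝ) / 10000; norm_num at *; linarith)) C hC s hs hm hd x hx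
  rcases le_total θ (19900 / 10000 : ℝ) with h5 | h5
  · exact rec_ok rc5 (Or.inr (by show Nat.Prime 3; norm_num)) rk5 θ (by show ((9010 : ℕ) : ℝ) / 10000 ≤ θ; norm_num at *; linarith) (Or.inr (by show θ ≤ ((19900 : ℕ) : ℝ) / 10000; norm_num at *; linarith)) C hC s hs hm hd x hx
  rcases le_total θ (34850 / 10000 : ℝ) with h6 | h6
  · exact rec_ok rc6 (Or.inr (by show Nat.Prime 3; norm_num)) rk6 θ (by show ((19900 : ℕ) : ℝ) / 10000 ≤ θ; norm_num at *; linarith) (Or.inr (by show θ ≤ ((34850 : ℕ) : ℝ) / 10000; norm_num at *; linarith)) C hC s hs hm hd x hx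
  exact rec_ok rc7 (Or.inr (by show Nat.Prime 3; norm_num)) rk7 θ (by show ((34850 : ℕ) : ℝ) / 10000 ≤ θ; norm_num at *; linarith) (Or.inl rfl) C hC s hs hm hd x hx

lemma good5 : good 5 7 := by
  intro θ C hθ hC s hs hm hd x hx
  rcases le_total θ (8420 / 10000 : ℝ) with h8 | h8
  · exact rec_ok rc8 (Or.inr (by show Nat.Prime 5; norm_num)) rk8 θ (by show ((5900 : ℕ) : ℝ) / 10000 ≤ θ; norm_num at *; linarith) (Or.inr (by show θ ≤ ((8420 : ℕ) : ℝ) / 10000; norm_num at *; linarith)) C hC s hs hm hd x hx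
  rcases le_total θ (15100 / 10000 : ℝ) with h9 | h9
  · exact rec_ok rc9 (Or.inr (by show Nat.Prime 5; norm_num)) rk9 θ (by show ((8420 : ℕ) : ℝ) / 10000 ≤ θ; norm_num at *; linarith) (Or.inr (by show θ ≤ ((15100 : ℕ) : ℝ) / 10000; norm_num at *; linarith)) C hC s hs hm hd x hx
  exact rec_ok rc10 (Or.inr (by show Nat.Prime 5; norm_num)) rk10 θ (by show ((15100 : ℕ) : ℝ) / 10000 ≤ θ; norm_num at *; linarith) (Or.inl rfl) C hC s hs hm hd x hx

lemma good7 : good 7 11 := by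
  intro θ C hθ hC s hs hm hd x hx
  rcases le_total θ (8070 / 10000 : ℝ) with h11 | h11
  · exact rec_ok rc11 (Or.inr (by show Nat.Prime 7; norm_num)) rk11 θ (by show ((5900 : ℕ) : ℝ) / 10000 ≤ θ; norm_num at *; linarith) (Or.inr (by show θ ≤ ((8070 : ℕ) : ℝ) / 10000; norm_num at *; linarith)) C hC s hs hm hd x hx
  rcases le_total θ (13870 / 10000 : ℝ) with h12 | h12
  · exact rec_ok rc12 (Or.inr (by show Nat.Prime 7; norm_num)) rk12 θ (by show ((8070 : ℕ) : ℝ) / 10000 ≤ θ; norm_num at *; linarith) (Or.inr (by show θ ≤ ((13870 : ℕ) : ℝ) / 10000; norm_num at *; linarith)) C hC s hs hm hd x hx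
  exact rec_ok rc13 (Or.inr (by show Nat.Prime 7; norm_num)) rk13 θ (by show ((13870 : ℕ) : ℝ) / 10000 ≤ θ; norm_num at *; linarith) (Or.inl rfl) C hC s hs hm hd x hx

lemma good11 : good 11 13 := by
  intro θ C hθ hC s hs hm hd x hx
  rcases le_total θ (7660 / 10000 : ℝ) with h14 | h14
  · exact rec_ok rc14 (Or.inr (by show Nat.Prime 11; norm_num)) rk14 θ (by show ((5900 : ℕ) : ℝ) / 10000 ≤ θ; norm_num at *; linarith) (Or.inr (by show θ ≤ ((7660 : ℕ) : ℝ) / 10000; norm_num at *; linarith)) C hC s hs hm hd x hx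
  rcases le_total θ (12110 / 10000 : ℝ) with h15 | h15
  · exact rec_ok rc15 (Or.inr (by show Nat.Prime 11; norm_num)) rk15 θ (by show ((7660 : ℕ) : ℝ) / 10000 ≤ θ; norm_num at *; linarith) (Or.inr (by show θ ≤ ((12110 : ℕ) : ℝ) / 10000; norm_num at *; linarith)) C hC s hs hm hd x hx
  exact rec_ok rc16 (Or.inr (by show Nat.Prime 11; norm_num)) rk16 θ (by show ((12110 : ℕ) : ℝ) / 10000 ≤ θ; norm_num at *; linarith) (Or.inl rfl) C hC s hs hm hd x hx

lemma good13 : good 13 17 := by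
  intro θ C hθ hC s hs hm hd x hx
  rcases le_total θ (7540 / 10000 : ℝ) with h17 | h17
  · exact rec_ok rc17 (Or.inr (by show Nat.Prime 13; norm_num)) rk17 θ (by show ((5900 : ℕ) : ℝ) / 10000 ≤ θ; norm_num at *; linarith) (Or.inr (by show θ ≤ ((7540 : ℕ) : ℝ) / 10000; norm_num at *; linarith)) C hC s hs hm hd x hx
  rcases le_total θ (12930 / 10000 : ℝ) with h18 | h18
  · exact rec_ok rc18 (Or.inr (by show Nat.Prime 13; norm_num)) rk18 θ (by show ((7540 : ℕ) : ℝ) / 10000 ≤ θ; norm_num at *; linarith) (Or.inr (by show θ ≤ ((12930 : ℕ) : ℝ) / 10000; norm_num at *; linarith)) C hC s hs hm hd x hx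
  exact rec_ok rc19 (Or.inr (by show Nat.Prime 13; norm_num)) rk19 θ (by show ((12930 : ℕ) : ℝ) / 10000 ≤ θ; norm_num at *; linarith) (Or.inl rfl) C hC s hs hm hd x hx

lemma good0 : good 0 17 := by
  intro θ C hθ hC s hs hm hd x hx
  rcases le_total θ (6130 / 10000 : ℝ) with h20 | h20
  · exact rec_ok rc20 (Or.inl rfl) rk20 θ (by show ((5900 : ℕ) : ℝ) / 10000 ≤ θ; norm_num at *; linarith) (Or.inr (by show θ ≤ ((6130 : ℕ) : ℝ) / 10000; norm_num at *; linarith)) C hC s hs hm hd x hx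
  rcases le_total θ (6490 / 10000 : ℝ) with h21 | h21
  · exact rec_ok rc21 (Or.inl rfl) rk21 θ (by show ((6130 : ℕ) : ℝ) / 10000 ≤ θ; norm_num at *; linarith) (Or.inr (by show θ ≤ ((6490 : ℕ) : ℝ) / 10000; norm_num at *; linarith)) C hC s hs hm hd x hx
  rcases le_total θ (7010 / 10000 : ℝ) with h22 | h22
  · exact rec_ok rc22 (Or.inl rfl) rk22 θ (by show ((6490 : ℕ) : ℝ) / 10000 ≤ θ; norm_num at *; linarith) (Or.inr (by show θ ≤ ((7010 : ℕ) : ℝ) / 10000; norm_num at *; linarith)) C hC s hs hm hd x hx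
  rcases le_total θ (7950 / 10000 : ℝ) with h23 | h23
  · exact rec_ok rc23 (Or.inl rfl) rk23 θ (by show ((7010 : ℕ) : ℝ) / 10000 ≤ θ; norm_num at *; linarith) (Or.inr (by show θ ≤ ((7950 : ℕ) : ℝ) / 10000; norm_num at *; linarith)) C hC s hs hm hd x hx
  rcases le_total θ (10180 / 10000 : ℝ) with h24 | h24
  · exact rec_ok rc24 (Or.inl rfl) rk24 θ (by show ((7950 : ℕ) : ℝ) / 10000 ≤ θ; norm_num at *; linarith) (Or.inr (by show θ ≤ ((10180 : ℕ) : ℝ) / 10000; norm_num at *; linarith)) C hC s hs hm hd x hx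
  exact rec_ok rc25 (Or.inl rfl) rk25 θ (by show ((10180 : ℕ) : ℝ) / 10000 ≤ θ; norm_num at *; linarith) (Or.inl rfl) C hC s hs hm hd x hx

lemma hard (C θ : ℝ) (hθ : 0.59 ≤ θ) (hC : 0.84556 ≤ C) (s : Finset ℕ) (hs : ∀ p ∈ s, p.Prime) (x : ℝ) (hx : 3 ≤ x) :
    Bd C θ x s := by
  have ne : ∀ a, a ∉ s → ∀ p ∈ s, p ≠ a := fun a ha p hp h => ha (h ▸ hp)
  by_cases h2 : 2 ∈ s
  · exact good_use 2 3 good2 (by norm_num) C θ hθ hC s hs h2 (fun p hp h => prime_ge3 p (hs p hp) h) x hx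
  by_cases h3 : 3 ∈ s
  · exact good_use 3 5 good3 (by norm_num) C θ hθ hC s hs h3 (fun p hp h => prime_ge5 p (hs p hp) (ne 2 h2 p hp) h) x hx
  by_cases h5 : 5 ∈ s
  · exact good_use 5 7 good5 (by norm_num) C θ hθ hC s hs h5
      (fun p hp h => prime_ge7 p (hs p hp) (ne 2 h2 p hp) (ne 3 h3 p hp) h) x hx
  by_cases h7 : 7 ∈ s
  · exact good_use 7 11 good7 (by norm_num) C θ hθ hC s hs h7
      (fun p hp h => prime_ge11 p (hs p hp) (ne 2 h2 p hp) (ne 3 h3 p hp) (ne 5 h5 p hp) h) x hx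
  by_cases h11 : 11 ∈ s
  · exact good_use 11 13 good11 (by norm_num) C θ hθ hC s hs h11
      (fun p hp h => prime_ge13 p (hs p hp) (ne 2 h2 p hp) (ne 3 h3 p hp) (ne 5 h5 p hp) (ne 7 h7 p hp) h) x hx
  by_cases h13 : 13 ∈ s
  · exact good_use 13 17 good13 (by norm_num) C θ hθ hC s hs h13
      (fun p hp h => prime_ge17 p (hs p hp) (ne 2 h2 p hp) (ne 3 h3 p hp) (ne 5 h5 p hp) (ne 7 h7 p hp) (ne 11 h11 p hp) h) x hx
  have := good0 θ C hθ hC s hs (fun p hp => prime_ge17 p (hs p hp) (ne 2 h2 p hp) (ne 3 h3 p hp) (ne 5 h5 p hp)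
    (ne 7 h7 p hp) (ne 11 h11 p hp) (ne 13 h13 p hp)) (by simp [s0]) x hx
  have e : s0 0 = ∅ := by simp [s0]
  rwa [e, union_empty] at this

lemma easy_all (C θ : ℝ) (hθ : θ ≤ 0.59) (hC : 0.84556 ≤ C) (hyp : ∀ y : ℝ, 1 ≤ y → |AA ∅ y| ≤ C * y ^ θ)
    (s : Finset ℕ) (hs : ∀ p ∈ s, p.Prime) (x : ℝ) (hx : 3 ≤ x) : Bd C θ x s := by
  have h := AA_bound ∅ (by simp) C 0 θ (by
    intro y hy
    rw [zero_mul, add_zero]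
    by_cases h : y < 1
    · exact easy C θ hC hθ y hy h
    · exact hyp y (by push Not at h; exact h)) s hs (by simp) x (by linarith)
  rw [union_empty, zero_mul, zero_mul, add_zero] at h
  refine h.trans ?_
  have S0 : 0 ≤ ∏ p ∈ s, (2 - 2 / (p : ℝ)) := prod_nonneg fun p hp => by
    have : (2 : ℝ) ≤ p := by exact_mod_cast (hs p hp).two_le
    have : 2 / (p : ℝ) ≤ 1 := by rw [div_le_one (by linarith)]; exact this
    linarith
  have := mul_nonneg (show 0 ≤ 1 - Real.eulerMascheroniConstant by linarith [gamma_hi]) S0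
  linarith

end S8

/-- Estimate for `∑_{d|q} μ(d) ∑_{n ≤ x, (n,q)=1} {x/(dn)}` assuming a bound in the
Dirichlet divisor problem. -/
theorem stmt_8 (C θ : ℝ) (hC : 0 < C) (hθ : 1 / 4 < θ)
    (hΔ : ∀ x : ℝ, 1 ≤ x →
      |(∑ n ∈ Finset.Icc 1 ⌊x⌋₊, (n.divisors.card : ℝ)) -
        (x * Real.log x + (2 * Real.eulerMascheroniConstant - 1) * x)| ≤ C * x ^ θ)
    (q : ℕ) (hq : 0 < q) (x : ℝ) (hx : 3 ≤ x) :
    |(∑ d ∈ q.divisors, (ArithmeticFunction.moebius d : ℝ) *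
        ∑ n ∈ (Finset.Icc 1 ⌊x⌋₊).filter (fun n => n.Coprime q), Int.fract (x / (d * n))) -
      ((q.totient : ℝ) / q) ^ 2 * (1 - Real.eulerMascheroniConstant -
        ∑ p ∈ q.primeFactors, Real.log p / ((p : ℝ) - 1)) * x| ≤
      C * (∑ d ∈ q.divisors, (ArithmeticFunction.moebius d : ℝ) ^ 2 * (d : ℝ) ^ (-θ)) ^ 2 * x ^ θ
        + (q.totient : ℝ) / q * 2 ^ q.primeFactors.card := by
  have hyp : ∀ y : ℝ, 1 ≤ y → |S8.AA ∅ y| ≤ C * y ^ θ := by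
    intro y hy
    have := hΔ y hy
    rw [S8.AA_empty, S8.DD, show y * (Real.log y + (2 * Real.eulerMascheroniConstant - 1)) =
      y * Real.log y + (2 * Real.eulerMascheroniConstant - 1) * y by ring]
    exact this
  have hC' : 0.84556 ≤ C := by
    have h := hΔ 1 le_rfl
    norm_num at h
    have g := S8.gamma_hi
    have := (abs_le.1 h).2
    linarith
  have hs : ∀ p ∈ q.primeFactors, p.Prime := fun p hp => Nat.prime_of_mem_primeFactors hp
  apply S8.reduction C θ q hq x hx
  · exact S8.EE_bound _ S8.EE_empty_bound q.primeFactors hs x (by linarith)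
  · rcases le_total θ 0.59 with h | h
    · exact S8.easy_all C θ h hC' hyp q.primeFactors hs x hx
    · exact S8.hard C θ h hC' q.primeFactors hs x hx
end
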